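/- arXiv:2210.02125 — 2 statements merged into one kernel-verified Lean document; each statement's English description precedes it below -/
import Mathlib

section
/- Let T ≥ 4 be an integer and fix B ∈ ℂ^{T×2} with B^H B = I_2. Let μ be the Haar probability measure on U(T). Then for every δ ∈ (0,1], the probability that a uniformly random 2-dimensional subspace has chordal product determinant at most δ with the column span of B is μ{U ∈ U(T) : det(I_2 − B^H (UE)(UE)^H B) ≤ δ} = (1/2)(T−1)(T−2)²(T−3) δ^{T−3} [ 1/(T−3) − 2δ/(T−2)² − δ²/(T−1) + 2δ·log(δ)/(T−2) ]. -/
open Matrix MeasureTheory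

noncomputable instance {m n : ℕ} : MeasureSpace (Matrix (Fin m) (Fin n) ℂ) := by
  unfold Matrix; infer_instance

/-- The `T × 2` matrix whose columns are the first 2 standard basis vectors of `ℂ^T`. -/
def stdFrame (T M : ℕ) : Matrix (Fin T) (Fin M) ℂ :=
  Matrix.of fun i j => if (i : ℕ) = (j : ℕ) then 1 else 0

namespace Chordal
open ProbabilityTheory Set Filter Topology
open scoped ENNReal

/-- The standard exponential distribution. -/
noncomputable def e1 : Measure ℝ :=
  (volume.restrict (Ioi 0)).withDensity (fun x => ENNReal.ofReal (Real.exp (-x)))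

lemma e1_Ici {r : ℝ} (hr : 0 ≤ r) : e1 (Ici r) = ENNReal.ofReal (Real.exp (-r)) := by
  rw [e1, withDensity_apply _ measurableSet_Ici, Measure.restrict_restrict measurableSet_Ici]
  have h : (Ici r ∩ Ioi 0 : Set ℝ) =ᵐ[volume] Ioi r := by
    have h1 : (Ici r ∩ Ioi 0 : Set ℝ) =ᵐ[volume] (Ioi r ∩ Ioi 0 : Set ℝ) :=
      Ioi_ae_eq_Ici.symm.inter (ae_eq_refl _)
    refine h1.trans (Filter.EventuallyEq.of_eq ?_)
    ext x; constructor
    · exact fun h => h.1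
    · exact fun h => ⟨h, hr.trans_lt h⟩
  rw [setLIntegral_congr h, ← ofReal_integral_eq_lintegral_ofReal, integral_exp_neg_Ioi]
  · exact integrableOn_exp_neg_Ioi r
  · exact Eventually.of_forall fun x => (Real.exp_pos _).le

instance : IsProbabilityMeasure e1 := by
  constructor
  have h : e1 univ = e1 (Ici 0) := by
    have : e1 (Iio 0) = 0 := by
      rw [e1, withDensity_apply _ measurableSet_Iio, Measure.restrict_restrict measurableSet_Iio]
      have : (Iio 0 ∩ Ioi 0 : Set ℝ) = ∅ := by
        ext x; simp only [mem_inter_iff, mem_Iio, mem_Ioi, mem_empty_iff_false, iff_false]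
        intro h; linarith [h.1, h.2]
      simp [this]
    have h2 : (univ : Set ℝ) = Iio 0 ∪ Ici 0 := by simp
    refine le_antisymm ?_ (measure_mono (subset_univ _))
    rw [h2]
    refine (measure_union_le _ _).trans ?_
    simp [this]
  rw [h, e1_Ici le_rfl]; simp

lemma e1_Iic_zero : e1 (Iic 0) = 0 := by
  rw [e1, withDensity_apply _ measurableSet_Iic, Measure.restrict_restrict measurableSet_Iic]
  have : (Iic 0 ∩ Ioi 0 : Set ℝ) = ∅ := by
    ext x; simp only [mem_inter_iff, mem_Iic, mem_Ioi, mem_empty_iff_false, iff_false]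
    intro h; linarith [h.1, h.2]
  simp [this]

lemma e1_Ici_neg {r : ℝ} (hr : r ≤ 0) : e1 (Ici r) = 1 := by
  refine le_antisymm prob_le_one ?_
  calc (1 : ℝ≥0∞) = e1 (Ici 0) := by rw [e1_Ici le_rfl]; simp
    _ ≤ _ := measure_mono (Ici_subset_Ici.2 hr)

/-- tail of the sum of two independent exponentials -/
lemma e1_two_tail {r : ℝ} (hr : 0 ≤ r) :
    (e1.prod e1) {p : ℝ × ℝ | r ≤ p.1 + p.2} = ENNReal.ofReal (Real.exp (-r) * (1 + r)) := by
  rw [Measure.prod_apply (measurableSet_le (by fun_prop) (by fun_prop))]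
  have h1 : ∀ x : ℝ, (Prod.mk x ⁻¹' {p : ℝ × ℝ | r ≤ p.1 + p.2}) = Ici (r - x) := by
    intro x; ext y; simp [add_comm]
  simp_rw [h1]
  have hm : Measurable fun x => e1 (Ici (r - x)) := by
    have := measurable_measure_prodMk_left (ν := e1)
      (s := {p : ℝ × ℝ | r ≤ p.1 + p.2}) (measurableSet_le (by fun_prop) (by fun_prop))
    simpa only [h1] using this
  rw [e1, lintegral_withDensity_eq_lintegral_mul _ (by fun_prop) (by exact hm), ← e1]
  have hsplit : Ioi (0:ℝ) = Ioc 0 r ∪ Ioi r := (Ioc_union_Ioi_eq_Ioi hr).symm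
  rw [hsplit, lintegral_union measurableSet_Ioi (by
    rw [Set.disjoint_left]; intro x hx hx'; exact absurd hx.2 (not_le.2 hx'))]
  have hA : ∫⁻ x in Ioc 0 r, ((fun x => ENNReal.ofReal (Real.exp (-x))) *
      fun x => e1 (Ici (r - x))) x = ENNReal.ofReal (r * Real.exp (-r)) := by
    rw [setLIntegral_congr_fun (g := fun _ => ENNReal.ofReal (Real.exp (-r))) measurableSet_Ioc]
    · rw [setLIntegral_const, Real.volume_Ioc, ← ENNReal.ofReal_mul (Real.exp_pos _).le]
      congr 1; ring
    · intro x hx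
      simp only [Pi.mul_apply]
      rw [e1_Ici (by linarith [hx.2]), ← ENNReal.ofReal_mul (Real.exp_pos _).le, ← Real.exp_add]
      congr 2; ring
  have hB : ∫⁻ x in Ioi r, ((fun x => ENNReal.ofReal (Real.exp (-x))) *
      fun x => e1 (Ici (r - x))) x = ENNReal.ofReal (Real.exp (-r)) := by
    rw [setLIntegral_congr_fun (g := fun x => ENNReal.ofReal (Real.exp (-x))) measurableSet_Ioi]
    · rw [← ofReal_integral_eq_lintegral_ofReal, integral_exp_neg_Ioi]
      · exact integrableOn_exp_neg_Ioi r
      · exact Eventually.of_forall fun x => (Real.exp_pos _).le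
    · intro x hx
      simp only [Pi.mul_apply]
      rw [e1_Ici_neg (by linarith [mem_Ioi.1 hx]), mul_one]
  rw [hA, hB, ← ENNReal.ofReal_add (by positivity) (by positivity)]
  congr 1; ring

lemma integrable_exp_e1 {t : ℝ} (ht : t < 1) : Integrable (fun x => Real.exp (t * x)) e1 := by
  rw [e1, integrable_withDensity_iff_integrable_smul' (by fun_prop)
    (Eventually.of_forall fun x => ENNReal.ofReal_lt_top)]
  have : IntegrableOn (fun x : ℝ => Real.exp ((t-1) * x)) (Ioi 0) :=
    integrableOn_exp_mul_Ioi (by linarith) 0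
  refine this.congr (Eventually.of_forall fun x => ?_)
  simp only [smul_eq_mul]
  rw [ENNReal.toReal_ofReal (Real.exp_pos _).le, ← Real.exp_add]
  congr 1; ring

lemma integral_exp_e1 {t : ℝ} (ht : t < 1) : ∫ x, Real.exp (t * x) ∂e1 = (1 - t)⁻¹ := by
  rw [e1, integral_withDensity_eq_integral_toReal_smul (by fun_prop)
    (Eventually.of_forall fun x => ENNReal.ofReal_lt_top)]
  have h : ∀ x : ℝ, (ENNReal.ofReal (Real.exp (-x))).toReal • Real.exp (t * x)
      = Real.exp ((t-1) * x) := by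
    intro x
    rw [smul_eq_mul, ENNReal.toReal_ofReal (Real.exp_pos _).le, ← Real.exp_add]
    congr 1; ring
  simp_rw [h]
  rw [integral_exp_mul_Ioi (by linarith)]
  have : t - 1 ≠ 0 := by linarith
  have : 1 - t ≠ 0 := by linarith
  field_simp
  simp

lemma ratio_cdf {Ω ι : Type*} [DecidableEq ι] [MeasurableSpace Ω] (P : Measure Ω)
    [IsProbabilityMeasure P]
    (X : ι → Ω → ℝ) (hX : iIndepFun X P) (hm : ∀ i, Measurable (X i))
    (hl : ∀ i, P.map (X i) = e1) (I : Finset ι) (p q : ι) (hpq : p ≠ q) (hp : p ∉ I) (hq : q ∉ I)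
    (y : ℝ) (hy0 : 0 < y) (hy1 : y ≤ 1) :
    P {ω | ∑ i ∈ I, X i ω ≤ y * (∑ i ∈ I, X i ω + X p ω + X q ω)}
      = ENNReal.ofReal ((I.card + 1) * y ^ I.card - I.card * y ^ (I.card + 1)) := by
  set S : Ω → ℝ := ∑ i ∈ I, X i with hS
  set c : ℝ := (1 - y) / y with hc
  have hc0 : 0 ≤ c := div_nonneg (by linarith) hy0.le
  have hSm : Measurable S := by
    have h : S = fun ω => ∑ i ∈ I, X i ω := by ext ω; simp [hS]
    rw [h]; exact Finset.measurable_sum _ fun i _ => hm i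
  have hset : {ω | ∑ i ∈ I, X i ω ≤ y * (∑ i ∈ I, X i ω + X p ω + X q ω)}
      = (fun ω => (S ω, (X p ω, X q ω))) ⁻¹' {v : ℝ × (ℝ × ℝ) | c * v.1 ≤ v.2.1 + v.2.2} := by
    ext ω
    simp only [mem_ofPred_eq, mem_preimage, hS, Finset.sum_apply, hc]
    rw [div_mul_eq_mul_div, div_le_iff₀ hy0]
    constructor <;> intro h <;> linarith
  have hms : MeasurableSet {v : ℝ × (ℝ × ℝ) | c * v.1 ≤ v.2.1 + v.2.2} :=
    measurableSet_le (by fun_prop) (by fun_prop)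
  have hind : IndepFun S (fun ω => (X p ω, X q ω)) P := by
    have h := hX.indepFun_finset I {p, q} (by
      rw [Finset.disjoint_left]; intro i hi hi'
      simp only [Finset.mem_insert, Finset.mem_singleton] at hi'
      rcases hi' with rfl | rfl <;> contradiction) hm
    have h2 := h.comp (φ := fun v : I → ℝ => ∑ i, v i)
      (ψ := fun v : ({p, q} : Finset ι) → ℝ =>
        (v ⟨p, by simp⟩, v ⟨q, by simp⟩)) (by fun_prop) (by fun_prop)
    have h3 : S = ((fun v : I → ℝ => ∑ i, v i) ∘ fun a i => X (↑i) a) := by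
      ext ω
      simp only [hS, Finset.sum_apply, Function.comp]
      exact (Finset.sum_coe_sort I (fun i => X i ω)).symm
    rw [h3]
    exact h2
  have hpq' : P.map (fun ω => (X p ω, X q ω)) = e1.prod e1 := by
    rw [(indepFun_iff_map_prod_eq_prod_map_map (hm p).aemeasurable (hm q).aemeasurable).1
      (hX.indepFun hpq), hl, hl]
  have hmap : P.map (fun ω => (S ω, (X p ω, X q ω))) = (P.map S).prod (e1.prod e1) := by
    rw [(indepFun_iff_map_prod_eq_prod_map_map hSm.aemeasurable
      ((hm p).prodMk (hm q)).aemeasurable).1 hind, hpq']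
  have hpos : ∀ᵐ ω ∂P, 0 ≤ S ω := by
    have h : ∀ i ∈ I, ∀ᵐ ω ∂P, 0 ≤ X i ω := by
      intro i _
      have : ∀ᵐ x ∂(P.map (X i)), 0 ≤ x := by
        rw [hl, ae_iff]
        refine measure_mono_null ?_ e1_Iic_zero
        intro x hx; simp at hx ⊢; linarith
      exact ae_of_ae_map (hm i).aemeasurable this
    have h' := (Finset.eventually_all I).2 h
    filter_upwards [h'] with ω hω
    rw [hS, Finset.sum_apply]
    exact Finset.sum_nonneg hω
  have hExpInt : ∀ i, ∀ t < 1, Integrable (fun ω => Real.exp (t * X i ω)) P := by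
    intro i t ht
    have := integrable_exp_e1 ht
    rw [← hl i] at this
    exact this.comp_measurable (hm i)
  have hmgf : ∀ t < 1, mgf S P t = ((1 - t)⁻¹) ^ I.card := by
    intro t ht
    rw [hS, hX.mgf_sum hm, Finset.prod_eq_pow_card]
    intro i _
    rw [mgf, ← integral_exp_e1 ht, ← hl i, integral_map (hm i).aemeasurable]
    exact (by fun_prop : Measurable fun x : ℝ => Real.exp (t * x)).aestronglyMeasurable
  have hintS : ∀ t < 1, Integrable (fun ω => Real.exp (t * S ω)) P := by
    intro t ht
    exact hX.integrable_exp_mul_sum hm (fun i _ => hExpInt i t ht)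
  have hinter : -c ∈ interior (integrableExpSet S P) := by
    rw [mem_interior]
    exact ⟨Iio 1, fun t ht => hintS t ht, isOpen_Iio, by simp; linarith⟩
  have hd1 := hasDerivAt_mgf hinter
  have hc1 : 1 - -c ≠ 0 := by linarith
  have hd2 : HasDerivAt (mgf S P) (I.card * ((1 - -c)⁻¹) ^ (I.card + 1)) (-c) := by
    have h0 : HasDerivAt (fun t : ℝ => ((1 - t)⁻¹) ^ I.card)
      (I.card * ((1 - -c)⁻¹) ^ (I.card - 1) * (-(-1) / (1 - -c)^2)) (-c) :=
      (((hasDerivAt_id (-c)).const_sub 1).inv hc1).pow I.card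
    have h1 : (fun t : ℝ => ((1 - t)⁻¹) ^ I.card) =ᶠ[𝓝 (-c)] mgf S P := by
      filter_upwards [Iio_mem_nhds (show -c < 1 by linarith)] with t ht
      exact (hmgf t ht).symm
    have h2 := h0.congr_of_eventuallyEq h1.symm
    have h3 : (I.card : ℝ) * ((1 - -c)⁻¹) ^ (I.card + 1)
        = I.card * ((1 - -c)⁻¹) ^ (I.card - 1) * (-(-1) / (1 - -c)^2) := by
      rcases Nat.eq_zero_or_pos I.card with h | h
      · rw [h]; simp
      · obtain ⟨m, hm⟩ := Nat.exists_eq_add_of_lt h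
        rw [hm, show 0 + m + 1 - 1 = m by omega, neg_neg, one_div, ← inv_pow]
        ring
    rw [h3]
    exact h2
  have hES := hd1.unique hd2
  have hyc : (1 - -c)⁻¹ = y := by
    rw [hc]; field_simp; ring
  rw [hset, ← Measure.map_apply (by fun_prop) hms, hmap, Measure.prod_apply hms]
  have hmm : Measurable fun x : ℝ => ENNReal.ofReal (Real.exp (-(c * x)) * (1 + c * x)) := by
    fun_prop
  have hae : ∀ᵐ x ∂(P.map S), (e1.prod e1) (Prod.mk x ⁻¹' {v : ℝ × (ℝ × ℝ) | c * v.1 ≤ v.2.1 + v.2.2})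
      = ENNReal.ofReal (Real.exp (-(c * x)) * (1 + c * x)) := by
    have : ∀ᵐ x ∂(P.map S), 0 ≤ x := by
      rw [ae_map_iff hSm.aemeasurable measurableSet_Ici]; exact hpos
    filter_upwards [this] with x hx
    exact e1_two_tail (mul_nonneg hc0 hx)
  rw [lintegral_congr_ae hae, lintegral_map hmm hSm]
  have hIS : Integrable (fun ω => S ω * Real.exp (-c * S ω)) P := by
    have := integrable_pow_mul_exp_of_mem_interior_integrableExpSet hinter 1
    simpa using this
  have hfe : ∀ ω, Real.exp (-(c * S ω)) * (1 + c * S ω)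
      = Real.exp (-c * S ω) + c * (S ω * Real.exp (-c * S ω)) := by
    intro ω; rw [neg_mul]; ring
  simp_rw [hfe]
  have hsum : Integrable (fun ω => Real.exp (-c * S ω) + c * (S ω * Real.exp (-c * S ω))) P :=
    (hintS _ (by linarith)).add (hIS.const_mul c)
  rw [← ofReal_integral_eq_lintegral_ofReal hsum]
  · have := hmgf (-c) (by linarith)
    rw [mgf] at this
    rw [integral_add (hintS _ (by linarith)) (hIS.const_mul c), integral_const_mul, hES, this, hyc]
    congr 1
    rw [hc]; field_simp; ring
  · filter_upwards [hpos] with ω hω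
    have := Real.exp_pos (-c * S ω)
    simp only [Pi.zero_apply]; positivity

end Chordal

namespace Chordal
open ProbabilityTheory Set Filter Topology
open scoped ENNReal

/-- The density model of the standard Gaussian on the complex plane. -/
noncomputable def g1 : Measure ℂ :=
  volume.withDensity (fun z => ENNReal.ofReal ((2 * Real.pi)⁻¹ * Real.exp (-(‖z‖ ^ 2 / 2))))

lemma radial_lintegral (φ : ℝ → ℝ≥0∞) (hφ : Measurable φ) :
    ∫⁻ z : ℂ, φ ‖z‖ = ENNReal.ofReal (2 * Real.pi) * ∫⁻ r in Ioi (0:ℝ), ENNReal.ofReal r * φ r := by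
  rw [← Complex.lintegral_comp_polarCoord_symm]
  simp_rw [Complex.norm_polarCoord_symm, smul_eq_mul]
  rw [polarCoord_target, Measure.volume_eq_prod, ← Measure.prod_restrict,
    lintegral_prod _ (by fun_prop)]
  simp only [lintegral_const, Measure.restrict_apply_univ, Real.volume_Ioo]
  rw [lintegral_mul_const _ (by fun_prop), mul_comm]
  congr 1
  · congr 1; ring
  · refine setLIntegral_congr_fun measurableSet_Ioi fun r hr => ?_
    simp only [abs_of_pos (mem_Ioi.1 hr)]

lemma tail_int {s : ℝ} (hs : 0 ≤ s) : ∫⁻ r in Ioi s, ENNReal.ofReal (r * Real.exp (-(r ^ 2 / 2)))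
    = ENNReal.ofReal (Real.exp (-(s ^ 2 / 2))) := by
  have hd : ∀ x ∈ Ici s, HasDerivAt (fun r : ℝ => -Real.exp (-(r ^ 2 / 2)))
      (x * Real.exp (-(x ^ 2 / 2))) x := by
    intro x _
    have h := ((((hasDerivAt_id x).pow 2).div_const 2).neg.exp).neg
    refine h.congr_deriv ?_
    simp; ring
  have hlim : Tendsto (fun r : ℝ => -Real.exp (-(r ^ 2 / 2))) atTop (𝓝 0) := by
    rw [← neg_zero]
    refine Tendsto.neg (Real.tendsto_exp_neg_atTop_nhds_zero.comp ?_)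
    exact (tendsto_pow_atTop two_ne_zero).atTop_div_const two_pos
  have hp : ∀ x ∈ Ioi s, 0 ≤ x * Real.exp (-(x ^ 2 / 2)) := by
    intro x hx
    have : 0 ≤ x := hs.trans (le_of_lt hx)
    positivity
  rw [← ofReal_integral_eq_lintegral_ofReal (integrableOn_Ioi_deriv_of_nonneg' hd hp hlim),
    integral_Ioi_of_hasDerivAt_of_nonneg' hd hp hlim]
  · simp
  · exact (ae_restrict_iff' measurableSet_Ioi).2 (Eventually.of_forall hp)

lemma g1_tail {r : ℝ} (hr : 0 ≤ r) :
    g1 {z : ℂ | r ≤ ‖z‖ ^ 2 / 2} = ENNReal.ofReal (Real.exp (-r)) := by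
  have hms : MeasurableSet {z : ℂ | r ≤ ‖z‖ ^ 2 / 2} :=
    measurableSet_le (by fun_prop) (by fun_prop)
  rw [g1, withDensity_apply _ hms, ← lintegral_indicator hms]
  have h := radial_lintegral (fun ρ => (Ici (Real.sqrt (2 * r))).indicator
    (fun ρ => ENNReal.ofReal ((2 * Real.pi)⁻¹ * Real.exp (-(ρ ^ 2 / 2)))) ρ)
    (Measurable.indicator (by fun_prop) measurableSet_Ici)
  have hi : ∀ ρ : ℝ, 0 ≤ ρ → (Real.sqrt (2 * r) ≤ ρ ↔ r ≤ ρ ^ 2 / 2) := by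
    intro ρ hρ
    rw [Real.sqrt_le_left hρ]
    constructor <;> intro h <;> linarith
  have h1 : ∀ z : ℂ, {z : ℂ | r ≤ ‖z‖ ^ 2 / 2}.indicator
      (fun z => ENNReal.ofReal ((2 * Real.pi)⁻¹ * Real.exp (-(‖z‖ ^ 2 / 2)))) z
      = (Ici (Real.sqrt (2 * r))).indicator
    (fun ρ => ENNReal.ofReal ((2 * Real.pi)⁻¹ * Real.exp (-(ρ ^ 2 / 2)))) ‖z‖ := by
    intro z
    by_cases hz : r ≤ ‖z‖ ^ 2 / 2
    · rw [indicator_of_mem (by exact hz), indicator_of_mem (by exact (hi _ (norm_nonneg z)).2 hz)]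
    · rw [indicator_of_notMem (by exact hz),
        indicator_of_notMem (by exact fun hh => hz ((hi _ (norm_nonneg z)).1 hh))]
  simp_rw [h1]
  rw [h]
  have h2 : ∀ ρ : ℝ, ENNReal.ofReal ρ * (Ici (Real.sqrt (2 * r))).indicator
    (fun ρ => ENNReal.ofReal ((2 * Real.pi)⁻¹ * Real.exp (-(ρ ^ 2 / 2)))) ρ
    = (Ici (Real.sqrt (2 * r))).indicator
      (fun ρ => ENNReal.ofReal ((2 * Real.pi)⁻¹) * ENNReal.ofReal (ρ * Real.exp (-(ρ ^ 2 / 2)))) ρ := by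
    intro ρ
    by_cases hz : ρ ∈ Ici (Real.sqrt (2 * r))
    · have : 0 ≤ ρ := (Real.sqrt_nonneg _).trans hz
      rw [indicator_of_mem hz, indicator_of_mem hz, ← ENNReal.ofReal_mul this,
        ← ENNReal.ofReal_mul (by positivity)]
      congr 1; ring
    · rw [indicator_of_notMem hz, indicator_of_notMem hz, mul_zero]
  simp_rw [h2]
  rw [lintegral_indicator measurableSet_Ici, Measure.restrict_restrict measurableSet_Ici]
  have h3 : (Ici (Real.sqrt (2 * r)) ∩ Ioi 0 : Set ℝ) =ᵐ[volume] Ioi (Real.sqrt (2 * r)) := by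
    have h1 : (Ici (Real.sqrt (2 * r)) ∩ Ioi 0 : Set ℝ) =ᵐ[volume]
        (Ioi (Real.sqrt (2 * r)) ∩ Ioi 0 : Set ℝ) :=
      Ioi_ae_eq_Ici.symm.inter (ae_eq_refl _)
    refine h1.trans (Filter.EventuallyEq.of_eq ?_)
    ext x; constructor
    · exact fun h => h.1
    · exact fun h => ⟨h, (Real.sqrt_nonneg _).trans_lt h⟩
  rw [setLIntegral_congr h3, lintegral_const_mul _ (by fun_prop), tail_int (Real.sqrt_nonneg _),
    ← ENNReal.ofReal_mul (by positivity), ← ENNReal.ofReal_mul (by positivity),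
    Real.sq_sqrt (by positivity)]
  congr 1
  have := Real.pi_pos
  field_simp

instance : IsProbabilityMeasure g1 := by
  constructor
  have := g1_tail (r := 0) le_rfl
  rw [show {z : ℂ | 0 ≤ ‖z‖ ^ 2 / 2} = univ from eq_univ_of_forall fun z => by
    show 0 ≤ ‖z‖ ^ 2 / 2; positivity] at this
  rw [this]; simp

lemma g1_law : g1.map (fun z => ‖z‖ ^ 2 / 2) = e1 := by
  have hm : Measurable fun z : ℂ => ‖z‖ ^ 2 / 2 := by fun_prop
  have : IsProbabilityMeasure (g1.map (fun z => ‖z‖ ^ 2 / 2)) :=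
    Measure.isProbabilityMeasure_map hm.aemeasurable
  refine Measure.ext_of_Ici _ _ fun r => ?_
  rw [Measure.map_apply hm measurableSet_Ici]
  rcases le_total 0 r with hr | hr
  · rw [e1_Ici hr]; exact g1_tail hr
  · rw [e1_Ici_neg hr]
    have : (fun z : ℂ => ‖z‖ ^ 2 / 2) ⁻¹' Ici r = univ := eq_univ_of_forall fun z => by
      show r ≤ ‖z‖ ^ 2 / 2
      have : 0 ≤ ‖z‖ ^ 2 / 2 := by positivity
      linarith
    rw [this]; simp

lemma g1_eq : g1 = stdGaussian ℂ := by
  apply Measure.ext_of_charFun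
  ext t
  rw [charFun_stdGaussian, charFun_apply, g1, integral_withDensity_eq_integral_toReal_smul (by fun_prop)
    (Eventually.of_forall fun x => ENNReal.ofReal_lt_top)]
  have h := GaussianFourier.integral_cexp_neg_mul_sq_norm_add (V := ℂ) (b := 1/2) (by norm_num) Complex.I t
  have h1 : ∀ z : ℂ, (ENNReal.ofReal ((2 * Real.pi)⁻¹ * Real.exp (-(‖z‖ ^ 2 / 2)))).toReal •
      Complex.exp (inner ℝ z t * Complex.I)
      = ((2 * Real.pi : ℝ) : ℂ)⁻¹ *
        Complex.exp (-(1/2) * ‖z‖ ^ 2 + Complex.I * inner ℝ t z) := by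
    intro z
    rw [ENNReal.toReal_ofReal (by positivity), Complex.exp_add, Complex.real_smul,
      real_inner_comm]
    push_cast
    rw [mul_assoc]
    rw [mul_comm (Complex.I) _]
    congr 3
    ring
  simp_rw [h1]
  rw [integral_const_mul, h, Complex.finrank_real_complex]
  have : ((Real.pi : ℂ)) ≠ 0 := by exact_mod_cast Real.pi_ne_zero
  push_cast
  simp
  field_simp
  congr 1
  ring

lemma std_eq_pi (ι : Type*) [Fintype ι] :
    stdGaussian (EuclideanSpace ℂ ι) = (Measure.pi (fun _ : ι => g1)).map (WithLp.toLp 2) := by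
  apply Measure.ext_of_charFun
  ext t
  simp_rw [g1_eq]
  rw [charFun_pi]
  simp_rw [charFun_stdGaussian, ← Complex.exp_sum]
  congr 1
  rw [← Finset.sum_div, Finset.sum_neg_distrib]
  congr 2
  norm_cast
  rw [EuclideanSpace.norm_sq_eq]

/-- scalar restriction of a complex linear isometry equivalence -/
def realIso {V W : Type*} [NormedAddCommGroup V] [InnerProductSpace ℂ V] [Module ℝ V]
    [IsScalarTower ℝ ℂ V] [NormedAddCommGroup W] [InnerProductSpace ℂ W] [Module ℝ W]
    [IsScalarTower ℝ ℂ W] (f : V ≃ₗᵢ[ℂ] W) : V ≃ₗᵢ[ℝ] W where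
  toLinearEquiv := f.toLinearEquiv.restrictScalars ℝ
  norm_map' := f.norm_map

lemma std_map_iso {ι κ : Type*} [Fintype ι] [Fintype κ]
    (f : EuclideanSpace ℂ ι ≃ₗᵢ[ℂ] EuclideanSpace ℂ κ) :
    (stdGaussian (EuclideanSpace ℂ ι)).map f = stdGaussian (EuclideanSpace ℂ κ) :=
  stdGaussian_map (realIso f)

lemma coord_indep {ι κ : Type*} [Fintype ι] [Fintype κ]
    (u : OrthonormalBasis κ ℂ (EuclideanSpace ℂ ι)) :
    iIndepFun (fun i (g : EuclideanSpace ℂ ι) => ‖u.repr g i‖ ^ 2 / 2)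
      (stdGaussian (EuclideanSpace ℂ ι)) ∧
    ∀ i, (stdGaussian (EuclideanSpace ℂ ι)).map (fun g => ‖u.repr g i‖ ^ 2 / 2) = e1 := by
  have hmap : (stdGaussian (EuclideanSpace ℂ ι)).map (fun g i => ‖u.repr g i‖ ^ 2 / 2)
      = Measure.pi fun _ : κ => e1 := by
    have h1 : (fun (g : EuclideanSpace ℂ ι) (i : κ) => ‖u.repr g i‖ ^ 2 / 2)
      = (fun (z : EuclideanSpace ℂ κ) (i : κ) => ‖z i‖ ^ 2 / 2) ∘ u.repr := rfl
    rw [h1, ← Measure.map_map (by fun_prop) (by fun_prop), std_map_iso, std_eq_pi,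
      Measure.map_map (by fun_prop) (by fun_prop)]
    have h2 := Measure.pi_map_pi (μ := fun _ : κ => g1) (f := fun (_ : κ) (z : ℂ) => ‖z‖ ^ 2 / 2)
      (fun i => by fun_prop)
    rw [g1_law] at h2
    exact h2
  have hl : ∀ i, (stdGaussian (EuclideanSpace ℂ ι)).map (fun g => ‖u.repr g i‖ ^ 2 / 2) = e1 := by
    intro i
    have := (measurePreserving_eval (fun _ : κ => e1) i).map_eq
    rw [← hmap, Measure.map_map (by fun_prop) (by fun_prop)] at this
    exact this
  refine ⟨?_, hl⟩
  rw [iIndepFun_iff_map_fun_eq_pi_map (fun i => by fun_prop)]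
  simp_rw [hl]
  exact hmap
end Chordal

namespace Chordal
open ProbabilityTheory Set Filter Topology
open scoped ENNReal ComplexConjugate

/-- Gram determinant of two vectors -/
noncomputable def gd {V : Type*} [NormedAddCommGroup V] [InnerProductSpace ℂ V] (x y : V) : ℝ :=
  ‖x‖ ^ 2 * ‖y‖ ^ 2 - ‖inner ℂ x y‖ ^ 2

/-- Set the first two coordinates to zero. -/
noncomputable def J {T : ℕ} (g : EuclideanSpace ℂ (Fin T)) : EuclideanSpace ℂ (Fin T) :=
  WithLp.toLp 2 fun i => if (i : ℕ) < 2 then 0 else g i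

lemma J_apply {T : ℕ} (g : EuclideanSpace ℂ (Fin T)) (i : Fin T) :
    J g i = if (i : ℕ) < 2 then 0 else g i := rfl

lemma inner_J_J {T : ℕ} (g h : EuclideanSpace ℂ (Fin T)) :
    inner ℂ (J g) (J h) = inner ℂ (J g) h := by
  simp only [PiLp.inner_apply, J_apply]
  refine Finset.sum_congr rfl fun i _ => ?_
  split_ifs <;> simp

lemma inner_J_sub {T : ℕ} (g : EuclideanSpace ℂ (Fin T)) :
    inner ℂ (J g) (g - J g) = 0 := by
  rw [inner_sub_right, inner_J_J, sub_self]

lemma sum_three {M : Type*} [AddCommMonoid M] {k : ℕ} (f : Fin (k + 3) → M) :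
    ∑ i, f i = f 0 + (f 1 + ∑ i : Fin (k + 1), f i.succ.succ) := by
  rw [Fin.sum_univ_succ, Fin.sum_univ_succ]; rfl

lemma norm_J_sq {k : ℕ} (h : EuclideanSpace ℂ (Fin (k + 3))) :
    ‖J h‖ ^ 2 + (‖h 0‖ ^ 2 + ‖h 1‖ ^ 2) = ‖h‖ ^ 2 := by
  rw [EuclideanSpace.norm_sq_eq, EuclideanSpace.norm_sq_eq, sum_three, sum_three]
  simp only [J_apply]
  simp
  ring

lemma norm_sub_J_sq {k : ℕ} (g : EuclideanSpace ℂ (Fin (k + 3))) :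
    ‖g - J g‖ ^ 2 = ‖g 0‖ ^ 2 + ‖g 1‖ ^ 2 := by
  rw [EuclideanSpace.norm_sq_eq, sum_three]
  simp [J_apply]

lemma inner_sub_J {k : ℕ} (g h : EuclideanSpace ℂ (Fin (k + 3))) :
    inner ℂ (g - J g) h = conj (g 0) * h 0 + conj (g 1) * h 1 := by
  rw [PiLp.inner_apply, sum_three]
  simp [J_apply, mul_comm]

/-- auxiliary vector orthogonal to `g` in the plane of the first two coordinates -/
noncomputable def wv {k : ℕ} (g : EuclideanSpace ℂ (Fin (k + 3))) : EuclideanSpace ℂ (Fin (k + 3)) :=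
  WithLp.toLp 2 fun i => if i = 0 then - conj (g 1) else if i = 1 then conj (g 0) else 0

lemma inner_wv {k : ℕ} (g h : EuclideanSpace ℂ (Fin (k + 3))) :
    inner ℂ (wv g) h = - g 1 * h 0 + g 0 * h 1 := by
  rw [PiLp.inner_apply, sum_three]
  have h1 : ∀ i : Fin (k+1), i.succ.succ ≠ 1 := by
    intro i h; rw [← Fin.succ_zero_eq_one, Fin.succ_inj] at h; exact Fin.succ_ne_zero _ h
  simp [wv, mul_comm, h1, Fin.succ_ne_zero]

lemma sq_identity (a b x y : ℂ) :
    ‖conj a * x + conj b * y‖ ^ 2 + ‖- b * x + a * y‖ ^ 2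
      = (‖a‖ ^ 2 + ‖b‖ ^ 2) * (‖x‖ ^ 2 + ‖y‖ ^ 2) := by
  simp only [← Complex.normSq_eq_norm_sq, Complex.normSq_apply]
  simp
  ring

lemma sq_identity2 (z w : ℂ) (α β γ : ℝ) (hα : α ≠ 0) (hβ : β ≠ 0) (hγ : γ ≠ 0)
    (h : γ ^ 2 = α ^ 2 + β ^ 2) :
    ‖((γ⁻¹ : ℝ) : ℂ) * (z + w)‖ ^ 2 + ‖((β / (α * γ) : ℝ) : ℂ) * z - ((α / (β * γ) : ℝ) : ℂ) * w‖ ^ 2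
      = ‖z‖ ^ 2 / α ^ 2 + ‖w‖ ^ 2 / β ^ 2 := by
  simp only [← Complex.normSq_eq_norm_sq, Complex.normSq_apply, Complex.mul_re, Complex.mul_im,
    Complex.sub_re, Complex.sub_im, Complex.add_re, Complex.add_im, Complex.ofReal_re,
    Complex.ofReal_im]
  field_simp
  rw [h]
  ring

lemma exists_basis {k : ℕ} (g : EuclideanSpace ℂ (Fin (k + 3))) (hc : J g ≠ 0)
    (ha : g - J g ≠ 0) :
    ∃ u : OrthonormalBasis (Fin (k + 3)) ℂ (EuclideanSpace ℂ (Fin (k + 3))),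
      ∀ h, gd g h = ‖g‖ ^ 2 * (∑ i ∈ Finset.univ \ {0, 1, 2}, ‖u.repr h i‖ ^ 2
            + ‖u.repr h 1‖ ^ 2 + ‖u.repr h 2‖ ^ 2) ∧
        gd (J g) (J h) = ‖J g‖ ^ 2 * (∑ i ∈ Finset.univ \ {0, 1, 2}, ‖u.repr h i‖ ^ 2) := by
  set a := g - J g with ha_def
  set c := J g with hc_def
  set α := ‖a‖ with hα
  set β := ‖c‖ with hβ
  set γ := ‖g‖ with hγ
  have hca : inner ℂ c a = 0 := inner_J_sub g
  have hac : inner ℂ a c = 0 := by rw [← inner_conj_symm, hca]; simp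
  have hg : g = a + c := by simp [ha_def]
  have hγ2 : γ ^ 2 = α ^ 2 + β ^ 2 := by
    rw [hγ, hα, norm_sub_J_sq, hβ, ← norm_J_sq g]; ring
  have hα0 : α ≠ 0 := norm_ne_zero_iff.2 ha
  have hβ0 : β ≠ 0 := norm_ne_zero_iff.2 hc
  have hγ0 : γ ≠ 0 := by
    intro h0
    have : 0 < α ^ 2 := by positivity
    have : 0 < β ^ 2 := by positivity
    rw [h0] at hγ2; linarith
  set w := wv g with hw
  have haa : inner ℂ a a = (α : ℂ) ^ 2 := inner_self_eq_norm_sq_to_K a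
  have hcc : inner ℂ c c = (β : ℂ) ^ 2 := inner_self_eq_norm_sq_to_K c
  have hwa : inner ℂ w a = 0 := by
    rw [inner_wv]; simp [ha_def, hc_def, J_apply]; ring
  have hwc : inner ℂ w c = 0 := by
    rw [inner_wv]; simp [hc_def, J_apply]
  have hww : inner ℂ w w = (α : ℂ) ^ 2 := by
    rw [inner_wv, hα]
    have := norm_sub_J_sq g
    rw [← ha_def] at this
    rw [← Complex.ofReal_pow, this]
    have h1 : ∀ z : ℂ, ((‖z‖ ^ 2 : ℝ) : ℂ) = z * conj z := by
      intro z; rw [Complex.mul_conj, Complex.normSq_eq_norm_sq]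
    rw [Complex.ofReal_add, h1, h1]
    simp [w, wv]; ring
  have haw : inner ℂ a w = 0 := by rw [← inner_conj_symm, hwa]; simp
  have hcw : inner ℂ c w = 0 := by rw [← inner_conj_symm, hwc]; simp
  set v0 : EuclideanSpace ℂ (Fin (k + 3)) := ((γ⁻¹ : ℝ) : ℂ) • (a + c) with hv0
  set v1 : EuclideanSpace ℂ (Fin (k + 3)) :=
    ((β / (α * γ) : ℝ) : ℂ) • a - ((α / (β * γ) : ℝ) : ℂ) • c with hv1
  set v2 : EuclideanSpace ℂ (Fin (k + 3)) := ((α⁻¹ : ℝ) : ℂ) • w with hv2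
  have hαC : (α : ℂ) ≠ 0 := by exact_mod_cast hα0
  have hβC : (β : ℂ) ≠ 0 := by exact_mod_cast hβ0
  have hγC : (γ : ℂ) ≠ 0 := by exact_mod_cast hγ0
  have hγ2C : (γ : ℂ) ^ 2 = α ^ 2 + β ^ 2 := by exact_mod_cast hγ2
  have i00 : inner ℂ v0 v0 = 1 := by
    simp only [hv0, inner_smul_left, inner_smul_right, inner_add_left, inner_add_right,
      haa, hcc, hac, hca, Complex.conj_ofReal]
    push_cast
    field_simp
    rw [hγ2C]; ring
  have i11 : inner ℂ v1 v1 = 1 := by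
    simp only [hv1, inner_smul_left, inner_smul_right, inner_sub_left, inner_sub_right,
      haa, hcc, hac, hca, Complex.conj_ofReal]
    push_cast
    field_simp
    rw [hγ2C]; ring
  have i22 : inner ℂ v2 v2 = 1 := by
    simp only [hv2, inner_smul_left, inner_smul_right, hww, Complex.conj_ofReal]
    push_cast
    field_simp
  have i01 : inner ℂ v0 v1 = 0 := by
    simp only [hv0, hv1, inner_smul_left, inner_smul_right, inner_sub_right,
      inner_add_left, haa, hcc, hac, hca, Complex.conj_ofReal]
    push_cast
    field_simp
    ring
  have i02 : inner ℂ v0 v2 = 0 := by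
    simp only [hv0, hv2, inner_smul_left, inner_smul_right,
      inner_add_left, haw, hcw]
    simp
  have i12 : inner ℂ v1 v2 = 0 := by
    simp only [hv1, hv2, inner_smul_left, inner_smul_right,
      inner_sub_left, haw, hcw]
    simp
  have i10 : inner ℂ v1 v0 = 0 := by rw [← inner_conj_symm, i01]; simp
  have i20 : inner ℂ v2 v0 = 0 := by rw [← inner_conj_symm, i02]; simp
  have i21 : inner ℂ v2 v1 = 0 := by rw [← inner_conj_symm, i12]; simp
  have n1 : ∀ v : EuclideanSpace ℂ (Fin (k + 3)), inner ℂ v v = (1 : ℂ) → ‖v‖ = 1 := by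
    intro v hv
    rw [norm_eq_sqrt_re_inner (𝕜 := ℂ), hv]
    simp
  have e10 : (1 : Fin (k + 3)) ≠ 0 := by simp [Fin.ext_iff]
  have e20 : (2 : Fin (k + 3)) ≠ 0 := by
    intro h; have := congrArg Fin.val h
    rw [Fin.val_two] at this; simp at this
  have e21 : (2 : Fin (k + 3)) ≠ 1 := by
    intro h; have := congrArg Fin.val h
    rw [Fin.val_two] at this; simp at this
  let v : Fin (k + 3) → EuclideanSpace ℂ (Fin (k + 3)) := fun i =>
    if i = 0 then v0 else if i = 1 then v1 else v2
  have w0 : v 0 = v0 := by simp [v]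
  have w1 : v 1 = v1 := by simp [v]
  have w2 : v 2 = v2 := by simp [v, e20, e21]
  have hv : Orthonormal ℂ (({0, 1, 2} : Set (Fin (k + 3))).domRestrict v) := by
    constructor
    · rintro ⟨i, hi⟩
      rcases hi with rfl | rfl | rfl
      · show ‖v 0‖ = 1
        rw [w0]; exact n1 _ i00
      · show ‖v 1‖ = 1
        rw [w1]; exact n1 _ i11
      · show ‖v 2‖ = 1
        rw [w2]; exact n1 _ i22
    · rintro ⟨i, hi⟩ ⟨j, hj⟩ hij
      have hij' : i ≠ j := fun h => hij (Subtype.ext h)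
      show inner ℂ (v i) (v j) = 0
      rcases hi with rfl | rfl | rfl <;> rcases hj with rfl | rfl | rfl <;>
        first
        | exact absurd rfl hij'
        | (simp only [w0, w1, w2]; assumption)
  obtain ⟨u, hu⟩ := hv.exists_orthonormalBasis_extension_of_card_eq (by simp)
  have u0 : u 0 = v0 := by rw [hu 0 (by simp), w0]
  have u1 : u 1 = v1 := by rw [hu 1 (by simp), w1]
  have u2 : u 2 = v2 := by rw [hu 2 (by simp), w2]
  refine ⟨u, fun h => ?_⟩
  have htot : ∑ i ∈ Finset.univ \ {0, 1, 2}, ‖u.repr h i‖ ^ 2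
      + (‖u.repr h 0‖ ^ 2 + ‖u.repr h 1‖ ^ 2 + ‖u.repr h 2‖ ^ 2) = ‖h‖ ^ 2 := by
    rw [← u.repr.norm_map h, EuclideanSpace.norm_sq_eq,
      ← Finset.sum_sdiff (Finset.subset_univ {0, 1, 2})]
    congr 1
    rw [Finset.sum_insert (by simp [e10.symm, e20.symm]), Finset.sum_insert (by simp [e21.symm]),
      Finset.sum_singleton, add_assoc]
  set z := inner ℂ a h with hz
  set t := inner ℂ c h with ht
  have r0 : u.repr h 0 = ((γ⁻¹ : ℝ) : ℂ) * (z + t) := by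
    rw [u.repr_apply_apply, u0, hv0, inner_smul_left, inner_add_left, Complex.conj_ofReal]
  have r1 : u.repr h 1 = ((β / (α * γ) : ℝ) : ℂ) * z - ((α / (β * γ) : ℝ) : ℂ) * t := by
    rw [u.repr_apply_apply, u1, hv1, inner_sub_left, inner_smul_left, inner_smul_left,
      Complex.conj_ofReal, Complex.conj_ofReal]
  have r2 : u.repr h 2 = ((α⁻¹ : ℝ) : ℂ) * inner ℂ w h := by
    rw [u.repr_apply_apply, u2, hv2, inner_smul_left, Complex.conj_ofReal]
  have hA : ‖u.repr h 0‖ ^ 2 = ‖inner ℂ g h‖ ^ 2 / γ ^ 2 := by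
    rw [r0, hg, inner_add_left, norm_mul, mul_pow, Complex.norm_real, norm_inv, inv_pow,
      Real.norm_eq_abs, sq_abs]
    ring
  have hB : ‖u.repr h 0‖ ^ 2 + ‖u.repr h 1‖ ^ 2 = ‖z‖ ^ 2 / α ^ 2 + ‖t‖ ^ 2 / β ^ 2 := by
    rw [r0, r1]; exact sq_identity2 z t α β γ hα0 hβ0 hγ0 hγ2
  have hC : ‖z‖ ^ 2 / α ^ 2 + ‖u.repr h 2‖ ^ 2 = ‖h 0‖ ^ 2 + ‖h 1‖ ^ 2 := by
    have h1 := sq_identity (g 0) (g 1) (h 0) (h 1)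
    rw [← inner_sub_J, ← inner_wv, ← norm_sub_J_sq g] at h1
    rw [r2, norm_mul, mul_pow, Complex.norm_real, norm_inv, inv_pow, Real.norm_eq_abs, sq_abs]
    have h2 : ‖z‖ ^ 2 + ‖inner ℂ w h‖ ^ 2 = α ^ 2 * (‖h 0‖ ^ 2 + ‖h 1‖ ^ 2) := h1
    field_simp
    linarith
  have hD := norm_J_sq h
  constructor
  · rw [gd]
    have h1 : ‖inner ℂ g h‖ ^ 2 = γ ^ 2 * ‖u.repr h 0‖ ^ 2 := by rw [hA]; field_simp
    rw [h1, ← htot]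
    ring
  · rw [gd, inner_J_J]
    have h1 : ‖inner ℂ (J g) h‖ ^ 2 = β ^ 2 * (‖t‖ ^ 2 / β ^ 2) := by
      field_simp; rfl
    rw [h1]
    have h2 : ‖J h‖ ^ 2 - ‖t‖ ^ 2 / β ^ 2 = ∑ i ∈ Finset.univ \ {0, 1, 2}, ‖u.repr h i‖ ^ 2 := by
      linarith
    rw [← h2]; ring
end Chordal

namespace Chordal
open ProbabilityTheory Set Filter Topology
open scoped ENNReal ComplexConjugate

/-- standard complex Gaussian measure on `ℂ^(k+3)` -/
noncomputable abbrev Gm (k : ℕ) : Measure (EuclideanSpace ℂ (Fin (k + 3))) :=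
  stdGaussian (EuclideanSpace ℂ (Fin (k + 3)))

/-- conditional cdf -/
noncomputable def Hk (k : ℕ) (δ s : ℝ) : ℝ :=
  if δ ≤ s then ((k : ℝ) + 1) * (δ / s) ^ k - k * (δ / s) ^ (k + 1) else 1

lemma repr_meas {k : ℕ} (u : OrthonormalBasis (Fin (k + 3)) ℂ (EuclideanSpace ℂ (Fin (k + 3))))
    (i : Fin (k + 3)) : Measurable (fun g => ‖u.repr g i‖ ^ 2 / 2) := by
  apply Continuous.measurable
  fun_prop

lemma two_ne_zero_fin {k : ℕ} : (2 : Fin (k + 3)) ≠ 0 := by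
  intro h; have := congrArg Fin.val h
  rw [Fin.val_two] at this; simp at this

lemma two_ne_one_fin {k : ℕ} : (2 : Fin (k + 3)) ≠ 1 := by
  intro h; have := congrArg Fin.val h
  rw [Fin.val_two] at this; simp at this

lemma card_sdiff3 {k : ℕ} : (Finset.univ \ {0, 1, 2} : Finset (Fin (k + 3))).card = k := by
  rw [Finset.card_sdiff_of_subset (Finset.subset_univ _), Finset.card_univ, Fintype.card_fin,
    Finset.card_insert_of_notMem (by simp [two_ne_zero_fin.symm]),
    Finset.card_insert_of_notMem (by simp [two_ne_one_fin.symm]), Finset.card_singleton]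
  omega

lemma card_sdiff2 {k : ℕ} : (Finset.univ \ {0, 1} : Finset (Fin (k + 3))).card = k + 1 := by
  rw [Finset.card_sdiff_of_subset (Finset.subset_univ _), Finset.card_univ, Fintype.card_fin,
    Finset.card_insert_of_notMem (by simp), Finset.card_singleton]
  omega

lemma coord_ae {k : ℕ} (u : OrthonormalBasis (Fin (k + 3)) ℂ (EuclideanSpace ℂ (Fin (k + 3))))
    (i : Fin (k + 3)) : ∀ᵐ h ∂(Gm k), 0 < ‖u.repr h i‖ ^ 2 := by
  have h1 := (coord_indep u).2 i
  have h2 : e1 (Iic 0) = 0 := e1_Iic_zero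
  rw [← h1, Measure.map_apply (repr_meas u i) measurableSet_Iic] at h2
  rw [ae_iff]
  refine measure_mono_null ?_ h2
  intro h hh
  have : ¬ 0 < ‖u.repr h i‖ ^ 2 := hh
  show ‖u.repr h i‖ ^ 2 / 2 ≤ 0
  linarith

lemma cond_cdf {k : ℕ} (g : EuclideanSpace ℂ (Fin (k + 3))) (hc : J g ≠ 0)
    (ha : g - J g ≠ 0) (δ : ℝ) (hδ : 0 < δ) :
    Gm k {h | gd (J g) (J h) ≤ δ * gd g h} = ENNReal.ofReal (Hk k δ (‖J g‖ ^ 2 / ‖g‖ ^ 2)) := by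
  obtain ⟨u, hu⟩ := exists_basis g hc ha
  have hβ : 0 < ‖J g‖ ^ 2 := by have := norm_pos_iff.2 hc; positivity
  have hg : 0 < ‖g‖ ^ 2 := by
    have := norm_J_sq g
    have h1 := sq_nonneg ‖g 0‖
    have h2 := sq_nonneg ‖g 1‖
    linarith
  obtain ⟨hi, hl⟩ := coord_indep u
  unfold Hk
  split_ifs with hs
  · have := ratio_cdf (Gm k) _ hi (repr_meas u) hl (Finset.univ \ {0, 1, 2}) 1 2
      two_ne_one_fin.symm (by simp) (by simp) (δ / (‖J g‖ ^ 2 / ‖g‖ ^ 2)) (by positivity)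
      (by rw [div_le_one (by positivity)]; exact hs)
    rw [card_sdiff3] at this
    rw [← this]
    congr 1
    ext h
    obtain ⟨h1, h2⟩ := hu h
    show gd (J g) (J h) ≤ δ * gd g h ↔ (_ : ℝ) ≤ _
    rw [h1, h2]
    simp only [← Finset.sum_div]
    set S := ∑ i ∈ Finset.univ \ {0, 1, 2}, ‖u.repr h i‖ ^ 2
    set a := ‖u.repr h 1‖ ^ 2
    set b := ‖u.repr h 2‖ ^ 2
    have e : δ / (‖J g‖ ^ 2 / ‖g‖ ^ 2) * (S / 2 + a / 2 + b / 2)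
      = (δ * (‖g‖ ^ 2 * (S + a + b))) / (2 * ‖J g‖ ^ 2) := by field_simp
    rw [e, div_le_div_iff₀ (by norm_num) (by positivity)]
    constructor <;> intro h <;> nlinarith
  · have : {h | gd (J g) (J h) ≤ δ * gd g h} = univ := by
      rw [eq_univ_iff_forall]
      intro h
      obtain ⟨h1, h2⟩ := hu h
      show gd (J g) (J h) ≤ δ * gd g h
      rw [h1, h2]
      have h3 : ‖J g‖ ^ 2 ≤ δ * ‖g‖ ^ 2 := by
        rw [not_le, div_lt_iff₀ hg] at hs; exact hs.le
      have h4 : 0 ≤ ∑ i ∈ Finset.univ \ {0, 1, 2}, ‖u.repr h i‖ ^ 2 :=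
        Finset.sum_nonneg fun i _ => sq_nonneg _
      have h5 := mul_le_mul_of_nonneg_right h3 h4
      have h6 : 0 ≤ δ * (‖g‖ ^ 2 * (‖u.repr h 1‖ ^ 2 + ‖u.repr h 2‖ ^ 2)) := by positivity
      linarith
    rw [this, measure_univ, ENNReal.ofReal_one]

lemma ae_gd {k : ℕ} (g : EuclideanSpace ℂ (Fin (k + 3))) (hc : J g ≠ 0)
    (ha : g - J g ≠ 0) : ∀ᵐ h ∂(Gm k), gd g h ≠ 0 := by
  obtain ⟨u, hu⟩ := exists_basis g hc ha
  have hβ : 0 < ‖J g‖ ^ 2 := by have := norm_pos_iff.2 hc; positivity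
  have hg : 0 < ‖g‖ ^ 2 := by
    have := norm_J_sq g
    have h1 := sq_nonneg ‖g 0‖
    have h2 := sq_nonneg ‖g 1‖
    linarith
  filter_upwards [coord_ae u 1] with h hh
  rw [(hu h).1]
  have h4 : 0 ≤ ∑ i ∈ Finset.univ \ {0, 1, 2}, ‖u.repr h i‖ ^ 2 :=
        Finset.sum_nonneg fun i _ => sq_nonneg _
  positivity

lemma ae_good (k : ℕ) : ∀ᵐ g ∂(Gm k), J g ≠ 0 ∧ g - J g ≠ 0 := by
  filter_upwards [coord_ae (EuclideanSpace.basisFun (Fin (k + 3)) ℂ) 0,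
    coord_ae (EuclideanSpace.basisFun (Fin (k + 3)) ℂ) 2] with g h0 h2
  rw [EuclideanSpace.basisFun_repr] at h0 h2
  constructor
  · intro h
    have : J g 2 = 0 := by rw [h]; rfl
    rw [J_apply, Fin.val_two, if_neg (by norm_num)] at this
    rw [this] at h2; simp at h2
  · intro h
    have := norm_sub_J_sq g
    rw [h] at this
    have h1 := sq_nonneg ‖g 1‖
    simp at this
    nlinarith

lemma s_cdf {k : ℕ} (y : ℝ) (hy0 : 0 < y) (hy1 : y ≤ 1) :
    Gm k {g | ‖J g‖ ^ 2 ≤ y * ‖g‖ ^ 2}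
      = ENNReal.ofReal (((k : ℝ) + 2) * y ^ (k + 1) - (k + 1) * y ^ (k + 2)) := by
  obtain ⟨hi, hl⟩ := coord_indep (EuclideanSpace.basisFun (Fin (k + 3)) ℂ)
  have := ratio_cdf (Gm k) _ hi (repr_meas _) hl (Finset.univ \ {0, 1}) 0 1
      (by simp) (by simp) (by simp) y hy0 hy1
  rw [card_sdiff2] at this
  have e : ((k : ℝ) + 2) * y ^ (k + 1) - (k + 1) * y ^ (k + 2)
    = (((k + 1 : ℕ) : ℝ) + 1) * y ^ (k + 1) - ((k + 1 : ℕ) : ℝ) * y ^ (k + 1 + 1) := by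
    push_cast; ring
  rw [e, ← this]
  congr 1
  ext g
  show (_ : ℝ) ≤ _ ↔ (_ : ℝ) ≤ _
  simp only [EuclideanSpace.basisFun_repr, ← Finset.sum_div]
  have h1 := norm_J_sq g
  have h2 : ∑ i ∈ Finset.univ \ {0, 1}, ‖g i‖ ^ 2 + (‖g 0‖ ^ 2 + ‖g 1‖ ^ 2) = ‖g‖ ^ 2 := by
    rw [EuclideanSpace.norm_sq_eq, ← Finset.sum_sdiff (Finset.subset_univ {0, 1})]
    congr 1
    rw [Finset.sum_insert (by simp), Finset.sum_singleton]
  have h3 : ∑ i ∈ Finset.univ \ {0, 1}, ‖g i‖ ^ 2 = ‖J g‖ ^ 2 := by linarith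
  rw [h3, ← h1]
  constructor <;> intro h <;> linarith
end Chordal

namespace Chordal
open ProbabilityTheory Set Filter Topology
open scoped ENNReal ComplexConjugate

lemma lint_ftc (Φ f : ℝ → ℝ) (a b : ℝ) (hab : a ≤ b) (hd : ∀ x ∈ Icc a b, HasDerivAt Φ (f x) x)
    (hf : ContinuousOn f (Icc a b)) (hn : ∀ x ∈ Ioc a b, 0 ≤ f x) :
    ∫⁻ x in Ioc a b, ENNReal.ofReal (f x) = ENNReal.ofReal (Φ b - Φ a) := by
  have hi : IntegrableOn f (Ioc a b) := (hf.integrableOn_Icc).mono_set Ioc_subset_Icc_self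
  rw [← ofReal_integral_eq_lintegral_ofReal hi
    (by filter_upwards [ae_restrict_mem measurableSet_Ioc] with x hx using hn x hx)]
  rw [← intervalIntegral.integral_of_le hab,
    intervalIntegral.integral_eq_sub_of_hasDerivAt]
  · rw [uIcc_of_le hab]; exact hd
  · exact (intervalIntegrable_iff_integrableOn_Ioc_of_le hab).2 hi

lemma ftc_nonneg (Φ f : ℝ → ℝ) (a b : ℝ) (hab : a ≤ b)
    (hd : ∀ x ∈ Icc a b, HasDerivAt Φ (f x) x)
    (hf : ContinuousOn f (Icc a b)) (hn : ∀ x ∈ Ioc a b, 0 ≤ f x) : 0 ≤ Φ b - Φ a := by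
  have hi : IntegrableOn f (Ioc a b) := (hf.integrableOn_Icc).mono_set Ioc_subset_Icc_self
  have h := setIntegral_nonneg measurableSet_Ioc hn (μ := volume)
  rw [← intervalIntegral.integral_of_le hab,
    intervalIntegral.integral_eq_sub_of_hasDerivAt] at h
  · exact h
  · rw [uIcc_of_le hab]; exact hd
  · exact (intervalIntegrable_iff_integrableOn_Ioc_of_le hab).2 hi

/-- density of the squared length ratio -/
noncomputable def dens (k : ℕ) (x : ℝ) : ℝ := ((k : ℝ) + 1) * (k + 2) * x ^ k * (1 - x)

lemma dens_nonneg (k : ℕ) (x : ℝ) (hx : x ∈ Ioc (0 : ℝ) 1) : 0 ≤ dens k x := by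
  have h0 := hx.1
  have h1 : 0 ≤ 1 - x := by linarith [hx.2]
  unfold dens
  positivity

lemma dens_lint (k : ℕ) (y : ℝ) (hy0 : 0 ≤ y) (hy1 : y ≤ 1) :
    ∫⁻ x in Ioc 0 y, ENNReal.ofReal (dens k x)
      = ENNReal.ofReal (((k : ℝ) + 2) * y ^ (k + 1) - (k + 1) * y ^ (k + 2)) := by
  rw [lint_ftc (fun y => ((k : ℝ) + 2) * y ^ (k + 1) - (k + 1) * y ^ (k + 2)) (dens k) 0 y hy0]
  · simp
  · intro x _
    have h1 := ((hasDerivAt_pow (k + 1) x).const_mul ((k : ℝ) + 2)).sub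
      ((hasDerivAt_pow (k + 2) x).const_mul ((k : ℝ) + 1))
    refine h1.congr_deriv ?_
    unfold dens
    simp only [Nat.add_sub_cancel, show k + 2 - 1 = k + 1 by omega]
    push_cast
    ring
  · unfold dens; fun_prop
  · intro x hx
    exact dens_nonneg k x ⟨hx.1, hx.2.trans hy1⟩

lemma J_cont (k : ℕ) : Continuous (J : EuclideanSpace ℂ (Fin (k + 3)) → _) := by
  unfold J
  refine (PiLp.continuous_toLp 2 _).comp (continuous_pi fun i => ?_)
  split_ifs
  · exact continuous_const
  · fun_prop

lemma gd_cont {V : Type*} [NormedAddCommGroup V] [InnerProductSpace ℂ V] :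
    Continuous (fun p : V × V => gd p.1 p.2) := by
  unfold gd
  fun_prop

/-- squared length ratio -/
noncomputable def sr {k : ℕ} (g : EuclideanSpace ℂ (Fin (k + 3))) : ℝ := ‖J g‖ ^ 2 / ‖g‖ ^ 2

lemma sr_meas (k : ℕ) : Measurable (sr : EuclideanSpace ℂ (Fin (k + 3)) → ℝ) := by
  unfold sr
  have := (J_cont k).measurable
  fun_prop

lemma sr_law (k : ℕ) : (Gm k).map sr =
    (volume.restrict (Ioc (0 : ℝ) 1)).withDensity (fun x => ENNReal.ofReal (dens k x)) := by
  have hm : Measurable (fun x => ENNReal.ofReal (dens k x)) := by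
    unfold dens; fun_prop
  have hpos : ∀ᵐ g ∂(Gm k), 0 < sr g := by
    filter_upwards [ae_good k] with g hg
    have h1 : 0 < ‖J g‖ := norm_pos_iff.2 hg.1
    have h2 : 0 < ‖g‖ ^ 2 := by
      have := norm_J_sq g
      have h1 := sq_nonneg ‖g 0‖
      have h2 := sq_nonneg ‖g 1‖
      have : 0 < ‖J g‖ ^ 2 := by positivity
      linarith
    unfold sr; positivity
  have : IsProbabilityMeasure ((Gm k).map sr) :=
    Measure.isProbabilityMeasure_map (sr_meas k).aemeasurable
  have key : ∀ y : ℝ, 0 < y → y ≤ 1 → (Gm k).map sr (Iic y) =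
      ENNReal.ofReal (((k : ℝ) + 2) * y ^ (k + 1) - (k + 1) * y ^ (k + 2)) := by
    intro y hy0 hy1
    rw [Measure.map_apply (sr_meas k) measurableSet_Iic, ← s_cdf y hy0 hy1]
    apply measure_congr
    filter_upwards [hpos] with g hg
    have h2 : 0 < ‖g‖ ^ 2 := by
      rcases (sq_nonneg ‖g‖).lt_or_eq with h | h
      · exact h
      · unfold sr at hg; rw [← h] at hg; simp at hg
    apply propext
    show ‖J g‖ ^ 2 / ‖g‖ ^ 2 ≤ y ↔ ‖J g‖ ^ 2 ≤ y * ‖g‖ ^ 2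
    rw [div_le_iff₀ h2]
  apply Measure.ext_of_Iic
  intro y
  rw [withDensity_apply _ measurableSet_Iic, Measure.restrict_restrict measurableSet_Iic]
  rcases le_or_gt y 0 with hy | hy
  · have e : Iic y ∩ Ioc (0 : ℝ) 1 = ∅ := by
      ext x; constructor
      · rintro ⟨h1, h2⟩; exact absurd (lt_of_lt_of_le h2.1 (le_trans h1 hy)) (lt_irrefl _)
      · rintro ⟨⟩
    rw [e, Measure.restrict_empty, lintegral_zero_measure,
      Measure.map_apply (sr_meas k) measurableSet_Iic]
    rw [ae_iff] at hpos
    refine measure_mono_null ?_ hpos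
    intro g hg
    show ¬ 0 < sr g
    exact not_lt.2 (le_trans hg hy)
  rcases le_or_gt y 1 with hy1 | hy1
  · have e : Iic y ∩ Ioc (0 : ℝ) 1 = Ioc 0 y := by
      ext x; constructor
      · rintro ⟨h1, h2⟩; exact ⟨h2.1, h1⟩
      · rintro ⟨h1, h2⟩; exact ⟨h2, h1, h2.trans hy1⟩
    rw [e, dens_lint k y hy.le hy1, key y hy hy1]
  · have e : Iic y ∩ Ioc (0 : ℝ) 1 = Ioc 0 1 := by
      ext x; constructor
      · rintro ⟨h1, h2⟩; exact h2
      · rintro ⟨h1, h2⟩; exact ⟨h2.trans hy1.le, h1, h2⟩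
    rw [e, dens_lint k 1 zero_le_one le_rfl, ← key 1 one_pos le_rfl]
    apply le_antisymm
    · refine prob_le_one.trans ?_
      rw [key 1 one_pos le_rfl]
      simp only [one_pow, mul_one]
      rw [← ENNReal.ofReal_one]
      apply ENNReal.ofReal_le_ofReal
      linarith
    · exact measure_mono (Iic_subset_Iic.2 hy1.le)

/-- final value -/
noncomputable def val (k : ℕ) (δ : ℝ) : ℝ :=
  ((k : ℝ) + 2) * δ ^ (k + 1) - (k + 1) * δ ^ (k + 2) +
    ((k : ℝ) + 1) * (k + 2) * (((k : ℝ) + 1) * δ ^ k * (1 / 2 - δ + δ ^ 2 / 2)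
      - k * δ ^ (k + 1) * (- 1 - Real.log δ + δ))

lemma val_eq (k : ℕ) (hk : 1 ≤ k) (δ : ℝ) : val k δ =
    (1 / 2) * (((k + 3 : ℕ) : ℝ) - 1) * (((k + 3 : ℕ) : ℝ) - 2) ^ 2 * (((k + 3 : ℕ) : ℝ) - 3)
      * δ ^ (k + 3 - 3) *
            (1 / (((k + 3 : ℕ) : ℝ) - 3) - 2 * δ / (((k + 3 : ℕ) : ℝ) - 2) ^ 2
              - δ ^ 2 / (((k + 3 : ℕ) : ℝ) - 1) +
              2 * δ * Real.log δ / (((k + 3 : ℕ) : ℝ) - 2)) := by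
  have hk' : (0 : ℝ) < k := by exact_mod_cast hk
  have e1 : (((k + 3 : ℕ) : ℝ) - 1) = k + 2 := by push_cast; ring
  have e2 : (((k + 3 : ℕ) : ℝ) - 2) = k + 1 := by push_cast; ring
  have e3 : (((k + 3 : ℕ) : ℝ) - 3) = k := by push_cast; ring
  rw [e1, e2, e3, Nat.add_sub_cancel]
  unfold val
  have h1 : (k : ℝ) + 1 ≠ 0 := by positivity
  have h2 : (k : ℝ) + 2 ≠ 0 := by positivity
  field_simp
  ring

lemma Hk_nonneg (k : ℕ) (δ s : ℝ) (hδ : 0 < δ) : 0 ≤ Hk k δ s := by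
  unfold Hk
  split_ifs with h
  · have hs : 0 < s := hδ.trans_le h
    have h1 : δ / s ≤ 1 := (div_le_one hs).2 h
    have h2 : 0 < δ / s := by positivity
    set y := δ / s
    have : ((k : ℝ) + 1) * y ^ k - k * y ^ (k + 1) = y ^ k * (1 + k * (1 - y)) := by ring
    rw [this]
    have : 0 ≤ 1 - y := by linarith
    positivity
  · exact zero_le_one

lemma Hk_meas (k : ℕ) (δ : ℝ) : Measurable (Hk k δ) := by
  unfold Hk
  refine Measurable.ite measurableSet_Ici ?_ measurable_const
  fun_prop

lemma int_val (k : ℕ) (δ : ℝ) (hδ : 0 < δ) (hδ1 : δ ≤ 1) :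
    ∫⁻ g, ENNReal.ofReal (Hk k δ (sr g)) ∂(Gm k) = ENNReal.ofReal (val k δ) := by
  have hm : Measurable (fun x => ENNReal.ofReal (dens k x)) := by
    unfold dens; fun_prop
  have hHm : Measurable (fun x => ENNReal.ofReal (Hk k δ x)) := (Hk_meas k δ).ennreal_ofReal
  rw [← lintegral_map (f := fun x => ENNReal.ofReal (Hk k δ x)) hHm (sr_meas k), sr_law,
    lintegral_withDensity_eq_lintegral_mul _ hm hHm,
    ← Ioc_union_Ioc_eq_Ioc hδ.le hδ1, lintegral_union measurableSet_Ioc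
      (Set.disjoint_left.2 fun x h1 h2 => absurd h2.1 (not_lt.2 h1.2))]
  have A : ∫⁻ x in Ioc 0 δ, ((fun x => ENNReal.ofReal (dens k x)) *
      (fun x => ENNReal.ofReal (Hk k δ x))) x =
      ENNReal.ofReal (((k : ℝ) + 2) * δ ^ (k + 1) - (k + 1) * δ ^ (k + 2)) := by
    rw [← dens_lint k δ hδ.le hδ1]
    refine setLIntegral_congr_fun measurableSet_Ioc ?_
    intro x hx
    have : Hk k δ x = 1 := by
      unfold Hk
      split_ifs with h
      · have : x = δ := le_antisymm hx.2 h
        rw [this, div_self hδ.ne']; simp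
      · rfl
    simp [this]
  have Bq : ∫⁻ x in Ioc δ 1, ((fun x => ENNReal.ofReal (dens k x)) *
      (fun x => ENNReal.ofReal (Hk k δ x))) x =
      ENNReal.ofReal (((k : ℝ) + 1) * (k + 2) * (((k : ℝ) + 1) * δ ^ k * (1 / 2 - δ + δ ^ 2 / 2)
      - k * δ ^ (k + 1) * (- 1 - Real.log δ + δ))) ∧
      0 ≤ ((k : ℝ) + 1) * (k + 2) * (((k : ℝ) + 1) * δ ^ k * (1 / 2 - δ + δ ^ 2 / 2)
      - k * δ ^ (k + 1) * (- 1 - Real.log δ + δ)) := by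
    have hn : ∀ x ∈ Ioc δ 1, ((k : ℝ) + 1) * (k + 2) * (((k : ℝ) + 1) * δ ^ k * (1 - x)
        - k * δ ^ (k + 1) * (x⁻¹ - 1)) = dens k x * Hk k δ x := by
      intro x hx
      have hx0 : x ≠ 0 := (hδ.trans hx.1).ne'
      unfold Hk dens
      rw [if_pos hx.1.le, div_pow, div_pow]
      field_simp
      ring
    have hd : ∀ x ∈ Icc δ 1, HasDerivAt (fun x => ((k : ℝ) + 1) * (k + 2) * (((k : ℝ) + 1) * δ ^ k * (x - x ^ 2 / 2)
      - k * δ ^ (k + 1) * (Real.log x - x)))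
      ((fun x => ((k : ℝ) + 1) * (k + 2) * (((k : ℝ) + 1) * δ ^ k * (1 - x)
      - k * δ ^ (k + 1) * (x⁻¹ - 1))) x) x := by
      intro x hx
      have hx0 : x ≠ 0 := (hδ.trans_le hx.1).ne'
      have h1 := ((((hasDerivAt_id x).sub ((hasDerivAt_pow 2 x).div_const 2)).const_mul
        (((k : ℝ) + 1) * δ ^ k)).sub
        (((Real.hasDerivAt_log hx0).sub (hasDerivAt_id x)).const_mul (k * δ ^ (k + 1)))).const_mul
        (((k : ℝ) + 1) * (k + 2))
      refine h1.congr_deriv ?_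
      simp
    have hcont : ContinuousOn (fun x => ((k : ℝ) + 1) * (k + 2) * (((k : ℝ) + 1) * δ ^ k * (1 - x)
      - k * δ ^ (k + 1) * (x⁻¹ - 1))) (Icc δ 1) := by
      have : ContinuousOn (fun x : ℝ => x⁻¹) (Icc δ 1) :=
        continuousOn_id.inv₀ fun x hx => (hδ.trans_le hx.1).ne'
      fun_prop
    have hpos : ∀ x ∈ Ioc δ 1, 0 ≤ (fun x => ((k : ℝ) + 1) * (k + 2) * (((k : ℝ) + 1) * δ ^ k * (1 - x)
      - k * δ ^ (k + 1) * (x⁻¹ - 1))) x := by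
      intro x hx
      show 0 ≤ _
      beta_reduce
      rw [hn x hx]
      exact mul_nonneg (dens_nonneg k x ⟨hδ.trans hx.1, hx.2⟩) (Hk_nonneg k δ x hδ)
    have key := And.intro (lint_ftc (fun x => ((k : ℝ) + 1) * (k + 2) * (((k : ℝ) + 1) * δ ^ k * (x - x ^ 2 / 2)
      - k * δ ^ (k + 1) * (Real.log x - x)))
      (fun x => ((k : ℝ) + 1) * (k + 2) * (((k : ℝ) + 1) * δ ^ k * (1 - x)
      - k * δ ^ (k + 1) * (x⁻¹ - 1))) δ 1 hδ1 hd hcont hpos) (ftc_nonneg (fun x => ((k : ℝ) + 1) * (k + 2) *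
      (((k : ℝ) + 1) * δ ^ k * (x - x ^ 2 / 2) - k * δ ^ (k + 1) * (Real.log x - x)))
      (fun x => ((k : ℝ) + 1) * (k + 2) * (((k : ℝ) + 1) * δ ^ k * (1 - x)
      - k * δ ^ (k + 1) * (x⁻¹ - 1))) δ 1 hδ1 hd hcont hpos)
    have e : ((k : ℝ) + 1) * (k + 2) * (((k : ℝ) + 1) * δ ^ k * (1 / 2 - δ + δ ^ 2 / 2)
      - k * δ ^ (k + 1) * (- 1 - Real.log δ + δ)) = (((k : ℝ) + 1) * (k + 2) * (((k : ℝ) + 1) * δ ^ k * (1 - 1 ^ 2 / 2)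
      - k * δ ^ (k + 1) * (Real.log 1 - 1))) - (((k : ℝ) + 1) * (k + 2) * (((k : ℝ) + 1) * δ ^ k * (δ - δ ^ 2 / 2)
      - k * δ ^ (k + 1) * (Real.log δ - δ))) := by
      rw [Real.log_one]; ring
    rw [e]
    refine ⟨?_, key.2⟩
    rw [← key.1]
    refine setLIntegral_congr_fun measurableSet_Ioc ?_
    intro x hx
    simp only [Pi.mul_apply]
    rw [hn x hx, ENNReal.ofReal_mul (dens_nonneg k x ⟨hδ.trans hx.1, hx.2⟩)]
  rw [A, Bq.1]
  have p1 : 0 ≤ ((k : ℝ) + 2) * δ ^ (k + 1) - (k + 1) * δ ^ (k + 2) := by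
    have : ((k : ℝ) + 2) * δ ^ (k + 1) - (k + 1) * δ ^ (k + 2)
      = δ ^ (k + 1) * (1 + (k + 1) * (1 - δ)) := by ring
    rw [this]
    have : 0 ≤ 1 - δ := by linarith
    positivity
  rw [← ENNReal.ofReal_add p1 Bq.2]
  rfl

lemma gauss_prob (k : ℕ) (δ : ℝ) (hδ : 0 < δ) (hδ1 : δ ≤ 1) :
    ((Gm k).prod (Gm k)) {p | gd (J p.1) (J p.2) ≤ δ * gd p.1 p.2} = ENNReal.ofReal (val k δ) := by
  have hms : MeasurableSet {p : EuclideanSpace ℂ (Fin (k + 3)) × EuclideanSpace ℂ (Fin (k + 3)) |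
      gd (J p.1) (J p.2) ≤ δ * gd p.1 p.2} := by
    refine (isClosed_le ?_ ?_).measurableSet
    · exact gd_cont.comp (((J_cont k).comp continuous_fst).prodMk ((J_cont k).comp continuous_snd))
    · exact continuous_const.mul gd_cont
  rw [Measure.prod_apply hms, ← int_val k δ hδ hδ1]
  apply lintegral_congr_ae
  filter_upwards [ae_good k] with g hg
  exact cond_cdf g hg.1 hg.2 δ hδ

lemma ae_gd_prod (k : ℕ) : ∀ᵐ p ∂((Gm k).prod (Gm k)), gd p.1 p.2 ≠ 0 := by
  have hms : MeasurableSet {p : EuclideanSpace ℂ (Fin (k + 3)) × EuclideanSpace ℂ (Fin (k + 3)) |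
      gd p.1 p.2 ≠ 0} := (gd_cont.measurable (measurableSet_singleton 0)).compl
  rw [Measure.ae_prod_iff_ae_ae hms]
  filter_upwards [ae_good k] with g hg
  exact ae_gd g hg.1 hg.2
end Chordal

namespace Chordal
open ProbabilityTheory Set Filter Topology
open scoped ENNReal ComplexConjugate

lemma gd_C {V : Type*} [NormedAddCommGroup V] [InnerProductSpace ℂ V] (x y : V) :
    ((gd x y : ℝ) : ℂ) = inner ℂ x x * inner ℂ y y - inner ℂ x y * inner ℂ y x := by
  have h1 : inner ℂ x x = ((‖x‖ ^ 2 : ℝ) : ℂ) := by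
    rw [Complex.ofReal_pow]; exact inner_self_eq_norm_sq_to_K x
  have h2 : inner ℂ y y = ((‖y‖ ^ 2 : ℝ) : ℂ) := by
    rw [Complex.ofReal_pow]; exact inner_self_eq_norm_sq_to_K y
  rw [h1, h2, ← inner_conj_symm y x, Complex.mul_conj, Complex.normSq_eq_norm_sq]
  unfold gd
  push_cast
  ring

lemma gd_comb {V : Type*} [NormedAddCommGroup V] [InnerProductSpace ℂ V] (x y : V) (r s t : ℂ) :
    gd (r • x) (s • x + t • y) = (‖r‖ ^ 2 * ‖t‖ ^ 2) * gd x y := by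
  have : ((gd (r • x) (s • x + t • y) : ℝ) : ℂ) = (((‖r‖ ^ 2 * ‖t‖ ^ 2) * gd x y : ℝ) : ℂ) := by
    rw [Complex.ofReal_mul, Complex.ofReal_mul, gd_C, gd_C, ← Complex.normSq_eq_norm_sq,
      ← Complex.normSq_eq_norm_sq, ← Complex.mul_conj, ← Complex.mul_conj]
    simp only [inner_add_left, inner_add_right, inner_smul_left, inner_smul_right]
    ring
  exact_mod_cast this

lemma gd_orth {V : Type*} [NormedAddCommGroup V] [InnerProductSpace ℂ V] (x y : V)
    (h : inner ℂ x y = 0) : gd x y = ‖x‖ ^ 2 * ‖y‖ ^ 2 := by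
  unfold gd; rw [h]; simp

lemma exists_gs {V : Type*} [NormedAddCommGroup V] [InnerProductSpace ℂ V] (g h : V)
    (hgd : gd g h ≠ 0) : ∃ (v : Fin 2 → V) (r s t : ℂ), Orthonormal ℂ v ∧
      g = r • v 0 ∧ h = s • v 0 + t • v 1 ∧ r ≠ 0 ∧ t ≠ 0 := by
  have hg : g ≠ 0 := by
    rintro rfl; apply hgd; unfold gd; simp
  have hgn : (‖g‖ : ℂ) ≠ 0 := by exact_mod_cast norm_ne_zero_iff.2 hg
  have hgg : inner ℂ g g = (‖g‖ : ℂ) ^ 2 := inner_self_eq_norm_sq_to_K g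
  set c : ℂ := inner ℂ g h / (‖g‖ : ℂ) ^ 2 with hc
  set w := h - c • g with hw
  have hgw : inner ℂ g w = 0 := by
    rw [hw, inner_sub_right, inner_smul_right, hgg, hc]; field_simp; simp
  have hh : h = c • g + (1 : ℂ) • w := by rw [hw]; simp
  have hw0 : w ≠ 0 := by
    intro h0
    apply hgd
    have := gd_comb g w 1 c 1
    rw [← hh, one_smul] at this
    rw [this, h0]; unfold gd; simp
  have hwn : (‖w‖ : ℂ) ≠ 0 := by exact_mod_cast norm_ne_zero_iff.2 hw0
  refine ⟨![(‖g‖ : ℂ)⁻¹ • g, (‖w‖ : ℂ)⁻¹ • w], ‖g‖, c * ‖g‖, ‖w‖, ⟨?_, ?_⟩, ?_, ?_, hgn, hwn⟩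
  · intro i
    fin_cases i
    · have := norm_ne_zero_iff.2 hg
      simp [norm_smul, this]
    · have := norm_ne_zero_iff.2 hw0
      simp [norm_smul, this]
  · have h1 : inner ℂ ((‖g‖ : ℂ)⁻¹ • g) ((‖w‖ : ℂ)⁻¹ • w) = 0 := by
      rw [inner_smul_left, inner_smul_right, hgw]; simp
    have h2 : inner ℂ ((‖w‖ : ℂ)⁻¹ • w) ((‖g‖ : ℂ)⁻¹ • g) = 0 := by
      rw [← inner_conj_symm, h1]; simp
    intro i j hij
    fin_cases i <;> fin_cases j
    · exact absurd rfl hij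
    · exact h1
    · exact h2
    · exact absurd rfl hij
  · simp [smul_smul, hgn]
  · simp only [Matrix.cons_val_zero, Matrix.cons_val_one, smul_smul]
    rw [mul_assoc, mul_inv_cancel₀ hgn, mul_inv_cancel₀ hwn, mul_one]
    exact hh

/-- action of the inverse of a unitary matrix -/
noncomputable def act {n : ℕ} (U : Matrix.unitaryGroup (Fin n) ℂ) (x : EuclideanSpace ℂ (Fin n)) :
    EuclideanSpace ℂ (Fin n) := WithLp.toLp 2 ((U : Matrix (Fin n) (Fin n) ℂ)ᴴ *ᵥ x.ofLp)

lemma act_add {n : ℕ} (U : Matrix.unitaryGroup (Fin n) ℂ) (x y : EuclideanSpace ℂ (Fin n)) :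
    act U (x + y) = act U x + act U y := by
  unfold act; rw [WithLp.ofLp_add, Matrix.mulVec_add, WithLp.toLp_add]

lemma act_smul {n : ℕ} (U : Matrix.unitaryGroup (Fin n) ℂ) (c : ℂ) (x : EuclideanSpace ℂ (Fin n)) :
    act U (c • x) = c • act U x := by
  unfold act; rw [WithLp.ofLp_smul, Matrix.mulVec_smul, WithLp.toLp_smul]

lemma act_mul {n : ℕ} (W U : Matrix.unitaryGroup (Fin n) ℂ) (x : EuclideanSpace ℂ (Fin n)) :
    act (W * U) x = act U (act W x) := by
  unfold act
  simp [Matrix.conjTranspose_mul, Matrix.mulVec_mulVec]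

lemma inner_act {n : ℕ} (U : Matrix.unitaryGroup (Fin n) ℂ) (x y : EuclideanSpace ℂ (Fin n)) :
    inner ℂ (act U x) (act U y) = inner ℂ x y := by
  have h : (U : Matrix (Fin n) (Fin n) ℂ) * (U : Matrix (Fin n) (Fin n) ℂ)ᴴ = 1 :=
    Matrix.mem_unitaryGroup_iff.1 U.2
  rw [EuclideanSpace.inner_eq_star_dotProduct, EuclideanSpace.inner_eq_star_dotProduct]
  unfold act
  rw [Matrix.star_mulVec, Matrix.conjTranspose_conjTranspose, dotProduct_comm,
    Matrix.dotProduct_mulVec, Matrix.vecMul_vecMul, h, Matrix.vecMul_one, dotProduct_comm]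

lemma gd_act {n : ℕ} (U : Matrix.unitaryGroup (Fin n) ℂ) (x y : EuclideanSpace ℂ (Fin n)) :
    gd (act U x) (act U y) = gd x y := by
  have : ((gd (act U x) (act U y) : ℝ) : ℂ) = ((gd x y : ℝ) : ℂ) := by
    simp only [gd_C, inner_act]
  exact_mod_cast this

lemma J_add {n : ℕ} (x y : EuclideanSpace ℂ (Fin n)) : J (x + y) = J x + J y := by
  ext i; simp only [J_apply, PiLp.add_apply]; split_ifs <;> simp

lemma J_smul {n : ℕ} (c : ℂ) (x : EuclideanSpace ℂ (Fin n)) : J (c • x) = c • J x := by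
  ext i; simp only [J_apply, PiLp.smul_apply]; split_ifs <;> simp

/-- the action as an isometry -/
noncomputable def actIso {n : ℕ} (U : Matrix.unitaryGroup (Fin n) ℂ) :
    EuclideanSpace ℂ (Fin n) ≃ₗᵢ[ℂ] EuclideanSpace ℂ (Fin n) :=
  LinearIsometry.toLinearIsometryEquiv
    { toFun := act U
      map_add' := act_add U
      map_smul' := act_smul U
      norm_map' := fun x => by
        show ‖act U x‖ = ‖x‖
        rw [norm_eq_sqrt_re_inner (𝕜 := ℂ), norm_eq_sqrt_re_inner (𝕜 := ℂ) x, inner_act] } rfl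

lemma actIso_apply {n : ℕ} (U : Matrix.unitaryGroup (Fin n) ℂ) (x : EuclideanSpace ℂ (Fin n)) :
    actIso U x = act U x := rfl

lemma exists_act {k : ℕ} (b v : Fin 2 → EuclideanSpace ℂ (Fin (k + 3))) (hb : Orthonormal ℂ b)
    (hv : Orthonormal ℂ v) : ∃ W : Matrix.unitaryGroup (Fin (k + 3)) ℂ, ∀ i, act W (b i) = v i := by
  have ext2 : ∀ b : Fin 2 → EuclideanSpace ℂ (Fin (k + 3)), Orthonormal ℂ b →
      ∃ u : OrthonormalBasis (Fin (k + 3)) ℂ (EuclideanSpace ℂ (Fin (k + 3))),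
        u 0 = b 0 ∧ u 1 = b 1 := by
    intro b hb
    let v : Fin (k + 3) → EuclideanSpace ℂ (Fin (k + 3)) := fun i =>
      if i = 0 then b 0 else b 1
    have w0 : v 0 = b 0 := by simp [v]
    have w1 : v 1 = b 1 := by simp [v]
    have hv : Orthonormal ℂ (({0, 1} : Set (Fin (k + 3))).domRestrict v) := by
      constructor
      · rintro ⟨i, hi⟩
        rcases hi with rfl | rfl
        · show ‖v 0‖ = 1
          rw [w0]; exact hb.1 0
        · show ‖v 1‖ = 1
          rw [w1]; exact hb.1 1
      · rintro ⟨i, hi⟩ ⟨j, hj⟩ hij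
        have hij2 : i ≠ j := fun h => hij (Subtype.ext h)
        show inner ℂ (v i) (v j) = 0
        rcases hi with rfl | rfl <;> rcases hj with rfl | rfl
        · exact absurd rfl hij2
        · rw [w0, w1]; exact hb.2 (by simp)
        · rw [w0, w1]; exact hb.2 (by simp)
        · exact absurd rfl hij2
    obtain ⟨u, hu⟩ := hv.exists_orthonormalBasis_extension_of_card_eq (by simp)
    exact ⟨u, by rw [hu 0 (by simp), w0], by rw [hu 1 (by simp), w1]⟩
  obtain ⟨p, hp0, hp1⟩ := ext2 b hb
  obtain ⟨q, hq0, hq1⟩ := ext2 v hv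
  let e := p.equiv q (Equiv.refl _)
  have he : ∀ i, e (p i) = q i := fun i => by simp [e]
  let M : Matrix (Fin (k + 3)) (Fin (k + 3)) ℂ :=
    Matrix.of fun i j => e (EuclideanSpace.single j 1) i
  have hM : ∀ x : EuclideanSpace ℂ (Fin (k + 3)), WithLp.toLp 2 (M *ᵥ x.ofLp) = e x := by
    intro x
    have hx : x = ∑ j, x j • EuclideanSpace.single j (1 : ℂ) := by
      have := (EuclideanSpace.basisFun (Fin (k + 3)) ℂ).sum_repr x
      simpa using this.symm
    conv_rhs => rw [hx]
    rw [map_sum]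
    ext i
    simp [M, Matrix.mulVec, dotProduct, mul_comm]
  have hMu : Mᴴ * M = 1 := by
    ext i j
    have h1 : inner ℂ (e (EuclideanSpace.single i (1 : ℂ))) (e (EuclideanSpace.single j (1 : ℂ)))
      = inner ℂ (EuclideanSpace.single i (1 : ℂ)) (EuclideanSpace.single j (1 : ℂ)) :=
      e.inner_map_map _ _
    rw [PiLp.inner_apply] at h1
    simp only [Matrix.mul_apply, Matrix.conjTranspose_apply, M, Matrix.of_apply, Matrix.one_apply]
    rw [EuclideanSpace.inner_single_left] at h1
    simp at h1
    simp [mul_comm]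
    rw [h1]
  have hMu2 : Mᴴ ∈ Matrix.unitaryGroup (Fin (k + 3)) ℂ := by
    rw [Matrix.mem_unitaryGroup_iff]
    show Mᴴ * (Mᴴ)ᴴ = 1
    rw [Matrix.conjTranspose_conjTranspose, hMu]
  refine ⟨⟨Mᴴ, hMu2⟩, fun i => ?_⟩
  have key : ∀ x, act ⟨Mᴴ, hMu2⟩ x = e x := by
    intro x; rw [← hM]; unfold act
    rw [Matrix.conjTranspose_conjTranspose]
  rw [key]
  fin_cases i
  · show e (b 0) = v 0
    rw [← hp0, he, hq0]
  · show e (b 1) = v 1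
    rw [← hp1, he, hq1]

lemma entry_meas {n : ℕ} (i j : Fin n) :
    Measurable (fun U : Matrix.unitaryGroup (Fin n) ℂ => (U : Matrix (Fin n) (Fin n) ℂ) i j) := by
  have h1 : Measurable (fun U : Matrix.unitaryGroup (Fin n) ℂ =>
    (U : Matrix (Fin n) (Fin n) ℂ)) := measurable_subtype_coe
  have h2 : Measurable (fun M : Matrix (Fin n) (Fin n) ℂ => M i) := measurable_pi_apply i
  have h3 : Measurable (fun v : Fin n → ℂ => v j) := measurable_pi_apply j
  exact h3.comp (h2.comp h1)

lemma mul_meas {n : ℕ} (W : Matrix.unitaryGroup (Fin n) ℂ) :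
    Measurable (fun U : Matrix.unitaryGroup (Fin n) ℂ => W * U) := by
  apply Measurable.subtype_mk
  refine measurable_pi_lambda (fun U : Matrix.unitaryGroup (Fin n) ℂ =>
    ((W : Matrix (Fin n) (Fin n) ℂ) * (U : Matrix (Fin n) (Fin n) ℂ))) fun i => ?_
  refine measurable_pi_lambda _ fun j => ?_
  simp only [Matrix.mul_apply]
  exact Finset.measurable_sum _ fun l _ => (entry_meas l j).const_mul _

lemma act_meas {n : ℕ} : Measurable (fun p : Matrix.unitaryGroup (Fin n) ℂ ×
    EuclideanSpace ℂ (Fin n) => act p.1 p.2) := by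
  unfold act
  refine (WithLp.measurable_toLp 2 _).comp (measurable_pi_lambda _ fun i => ?_)
  simp only [Matrix.mulVec, dotProduct, Matrix.conjTranspose_apply]
  refine Finset.measurable_sum _ fun l _ => ?_
  refine Measurable.mul ?_ ?_
  · exact (continuous_star.measurable).comp ((entry_meas l i).comp measurable_fst)
  · have : Measurable (fun x : EuclideanSpace ℂ (Fin n) => x l) :=
      Continuous.measurable (by fun_prop)
    exact this.comp measurable_snd

lemma jact_meas {k : ℕ} {α : Type*} [MeasurableSpace α]
    (f : α → Matrix.unitaryGroup (Fin (k + 3)) ℂ) (g : α → EuclideanSpace ℂ (Fin (k + 3)))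
    (hf : Measurable f) (hg : Measurable g) : Measurable (fun a => J (act (f a) (g a))) := by
  have h1 : Measurable (fun a => (f a, g a)) := hf.prodMk hg
  have h2 : Measurable (fun a => act (f a) (g a)) := Measurable.comp (g := fun p :
    Matrix.unitaryGroup (Fin (k + 3)) ℂ × EuclideanSpace ℂ (Fin (k + 3)) => act p.1 p.2)
    (f := fun a => (f a, g a)) act_meas h1
  have h3 : Measurable (J : EuclideanSpace ℂ (Fin (k + 3)) → _) := (J_cont k).measurable
  exact Measurable.comp (g := J) (f := fun a => act (f a) (g a)) h3 h2

lemma gd_meas {k : ℕ} {α : Type*} [MeasurableSpace α]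
    (f g : α → EuclideanSpace ℂ (Fin (k + 3)))
    (hf : Measurable f) (hg : Measurable g) : Measurable (fun a => gd (f a) (g a)) := by
  have h1 : Measurable (fun a => (f a, g a)) := hf.prodMk hg
  exact gd_cont.measurable.comp h1

lemma haar_prob (k : ℕ) (μ : Measure (Matrix.unitaryGroup (Fin (k + 3)) ℂ))
    [IsProbabilityMeasure μ] [μ.IsMulLeftInvariant]
    (b : Fin 2 → EuclideanSpace ℂ (Fin (k + 3))) (hb : Orthonormal ℂ b)
    (δ : ℝ) (hδ : 0 < δ) (hδ1 : δ ≤ 1) :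
    μ {U | gd (J (act U (b 0))) (J (act U (b 1))) ≤ δ} = ENNReal.ofReal (val k δ) := by
  let S : Set (Matrix.unitaryGroup (Fin (k + 3)) ℂ ×
      (EuclideanSpace ℂ (Fin (k + 3)) × EuclideanSpace ℂ (Fin (k + 3)))) :=
    {q | gd (J (act q.1 q.2.1)) (J (act q.1 q.2.2)) ≤ δ * gd q.2.1 q.2.2}
  have hS : MeasurableSet S := by
    have m1 := jact_meas (k := k) (fun q : Matrix.unitaryGroup (Fin (k + 3)) ℂ ×
      (EuclideanSpace ℂ (Fin (k + 3)) × EuclideanSpace ℂ (Fin (k + 3))) => q.1)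
      (fun q => q.2.1) measurable_fst (measurable_fst.comp measurable_snd)
    have m2 := jact_meas (k := k) (fun q : Matrix.unitaryGroup (Fin (k + 3)) ℂ ×
      (EuclideanSpace ℂ (Fin (k + 3)) × EuclideanSpace ℂ (Fin (k + 3))) => q.1)
      (fun q => q.2.2) measurable_fst (measurable_snd.comp measurable_snd)
    have m3 := gd_meas (k := k) (fun q : Matrix.unitaryGroup (Fin (k + 3)) ℂ ×
      (EuclideanSpace ℂ (Fin (k + 3)) × EuclideanSpace ℂ (Fin (k + 3))) => q.2.1)
      (fun q => q.2.2) (measurable_fst.comp measurable_snd) (measurable_snd.comp measurable_snd)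
    exact measurableSet_le (gd_meas _ _ m1 m2) (m3.const_mul δ)
  have A1 : (μ.prod ((Gm k).prod (Gm k))) S = ENNReal.ofReal (val k δ) := by
    rw [Measure.prod_apply hS]
    have : ∀ U, ((Gm k).prod (Gm k)) (Prod.mk U ⁻¹' S) = ENNReal.ofReal (val k δ) := by
      intro U
      rw [← gauss_prob k δ hδ hδ1]
      have hmap : ((Gm k).prod (Gm k)).map (Prod.map (actIso U) (actIso U))
          = (Gm k).prod (Gm k) := by
        rw [← Measure.map_prod_map _ _ (actIso U).continuous.measurable
          (actIso U).continuous.measurable, std_map_iso]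
      have hms : MeasurableSet {p : EuclideanSpace ℂ (Fin (k + 3)) × EuclideanSpace ℂ (Fin (k + 3)) |
          gd (J p.1) (J p.2) ≤ δ * gd p.1 p.2} := by
        refine (isClosed_le ?_ ?_).measurableSet
        · exact gd_cont.comp (((J_cont k).comp continuous_fst).prodMk
            ((J_cont k).comp continuous_snd))
        · exact continuous_const.mul gd_cont
      conv_rhs => rw [← hmap]
      rw [Measure.map_apply ((actIso U).continuous.measurable.prodMap
        (actIso U).continuous.measurable) hms]
      congr 1
      ext p
      show gd (J (act U p.1)) (J (act U p.2)) ≤ δ * gd p.1 p.2 ↔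
        gd (J (act U p.1)) (J (act U p.2)) ≤ δ * gd (act U p.1) (act U p.2)
      rw [gd_act]
    simp [this]
  have A2 : (μ.prod ((Gm k).prod (Gm k))) S =
      μ {U | gd (J (act U (b 0))) (J (act U (b 1))) ≤ δ} := by
    rw [Measure.prod_apply_symm hS]
    have : ∀ᵐ p ∂((Gm k).prod (Gm k)), μ ((fun U => (U, p)) ⁻¹' S)
        = μ {U | gd (J (act U (b 0))) (J (act U (b 1))) ≤ δ} := by
      filter_upwards [ae_gd_prod k] with p hp
      obtain ⟨v, r, s, t, hv, hg, hh, hr, ht⟩ := exists_gs p.1 p.2 hp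
      obtain ⟨W, hW⟩ := exists_act b v hb hv
      have hms : MeasurableSet {U : Matrix.unitaryGroup (Fin (k + 3)) ℂ |
          gd (J (act U (b 0))) (J (act U (b 1))) ≤ δ} := by
        refine measurableSet_le ?_ measurable_const
        exact gd_meas _ _ (jact_meas _ _ measurable_id measurable_const)
          (jact_meas _ _ measurable_id measurable_const)
      have hinv : μ.map (fun U => W * U) = μ := Measure.IsMulLeftInvariant.map_mul_left_eq_self W
      conv_rhs => rw [← hinv]
      rw [Measure.map_apply (mul_meas W) hms]
      congr 1
      ext U
      show gd (J (act U p.1)) (J (act U p.2)) ≤ δ * gd p.1 p.2 ↔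
        gd (J (act (W * U) (b 0))) (J (act (W * U) (b 1))) ≤ δ
      have hgv : gd (v 0) (v 1) = 1 := by
        rw [gd_orth _ _ (hv.2 (by simp)), hv.1, hv.1]; simp
      rw [act_mul, act_mul, hW, hW, hg, hh, gd_comb, hgv]
      rw [act_smul, act_add, act_smul, act_smul, J_smul, J_add, J_smul, J_smul, gd_comb]
      have hrt : 0 < ‖r‖ ^ 2 * ‖t‖ ^ 2 := by
        have := norm_pos_iff.2 hr
        have := norm_pos_iff.2 ht
        positivity
      rw [mul_one, mul_comm δ]
      exact mul_le_mul_iff_right₀ hrt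
    rw [lintegral_congr_ae this]
    simp
  rw [← A2, A1]

lemma det_eq (k : ℕ) (B : Matrix (Fin (k + 3)) (Fin 2) ℂ) (hB : Bᴴ * B = 1)
    (U : Matrix.unitaryGroup (Fin (k + 3)) ℂ) :
    ((1 - Bᴴ * ((U : Matrix (Fin (k + 3)) (Fin (k + 3)) ℂ) * stdFrame (k + 3) 2) *
            ((U : Matrix (Fin (k + 3)) (Fin (k + 3)) ℂ) * stdFrame (k + 3) 2)ᴴ * B).det).re =
      gd (J (act U (WithLp.toLp 2 fun i => B i 0))) (J (act U (WithLp.toLp 2 fun i => B i 1))) := by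
  set b : Fin 2 → EuclideanSpace ℂ (Fin (k + 3)) := fun j => WithLp.toLp 2 fun i => B i j with hb
  have hBb : ∀ i j, inner ℂ (b i) (b j) = (1 : Matrix (Fin 2) (Fin 2) ℂ) i j := by
    intro i j
    rw [← hB, PiLp.inner_apply]
    simp [Matrix.mul_apply, hb, mul_comm]
  have hent : ∀ i j : Fin 2, (1 - Bᴴ * ((U : Matrix (Fin (k + 3)) (Fin (k + 3)) ℂ) * stdFrame (k + 3) 2) *
            ((U : Matrix (Fin (k + 3)) (Fin (k + 3)) ℂ) * stdFrame (k + 3) 2)ᴴ * B : Matrix (Fin 2) (Fin 2) ℂ) i j =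
      inner ℂ (J (act U (b i))) (J (act U (b j))) := by
    intro i j
    have h1 := inner_sub_J (act U (b i)) (act U (b j))
    rw [inner_sub_left, ← inner_J_J, inner_act, hBb] at h1
    rw [Matrix.sub_apply]
    have h2 : ∀ j (m : Fin 2), (((U : Matrix (Fin (k + 3)) (Fin (k + 3)) ℂ) * stdFrame (k + 3) 2)ᴴ * B) m j
        = act U (b j) (Fin.castLE (by omega) m) := by
      intro j m
      rw [Matrix.conjTranspose_mul, Matrix.mul_assoc, Matrix.mul_apply,
        Finset.sum_eq_single (Fin.castLE (by omega) m : Fin (k + 3))]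
      · simp [stdFrame, act, Matrix.mul_apply, Matrix.mulVec, dotProduct, hb]
      · intro l _ hl
        have : (l : ℕ) ≠ (m : ℕ) := fun h => hl (Fin.ext (by simpa using h))
        simp [stdFrame, this]
      · simp
    have h3 : (Bᴴ * ((U : Matrix (Fin (k + 3)) (Fin (k + 3)) ℂ) * stdFrame (k + 3) 2) *
            ((U : Matrix (Fin (k + 3)) (Fin (k + 3)) ℂ) * stdFrame (k + 3) 2)ᴴ * B) i j
        = conj (act U (b i) 0) * act U (b j) 0 + conj (act U (b i) 1) * act U (b j) 1 := by
      set Q := ((U : Matrix (Fin (k + 3)) (Fin (k + 3)) ℂ) * stdFrame (k + 3) 2)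
      clear_value Q
      have e : Bᴴ * Q * Qᴴ * B = (Qᴴ * B)ᴴ * (Qᴴ * B) := by
        rw [Matrix.conjTranspose_mul, Matrix.conjTranspose_conjTranspose, Matrix.mul_assoc]
      rw [e, Matrix.mul_apply, Fin.sum_univ_two, Matrix.conjTranspose_apply,
        Matrix.conjTranspose_apply, h2, h2, h2, h2]
      rfl
    rw [h3, ← h1]
    ring
  rw [Matrix.det_fin_two, hent, hent, hent, hent, ← gd_C, Complex.ofReal_re]

end Chordal

theorem chordal_product_cdf_M2
    (T : ℕ) (hT : 4 ≤ T)
    (B : Matrix (Fin T) (Fin 2) ℂ) (hB : Bᴴ * B = 1)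
    (μ : Measure (Matrix.unitaryGroup (Fin T) ℂ))
    [IsProbabilityMeasure μ] [μ.IsMulLeftInvariant]
    (δ : ℝ) (hδ0 : 0 < δ) (hδ1 : δ ≤ 1) :
    μ {U : Matrix.unitaryGroup (Fin T) ℂ |
        ((1 - Bᴴ * ((U : Matrix (Fin T) (Fin T) ℂ) * stdFrame T 2) *
            ((U : Matrix (Fin T) (Fin T) ℂ) * stdFrame T 2)ᴴ * B).det).re ≤ δ}
      = ENNReal.ofReal
          ((1 / 2) * ((T : ℝ) - 1) * ((T : ℝ) - 2) ^ 2 * ((T : ℝ) - 3) * δ ^ (T - 3) *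
            (1 / ((T : ℝ) - 3) - 2 * δ / ((T : ℝ) - 2) ^ 2 - δ ^ 2 / ((T : ℝ) - 1) +
              2 * δ * Real.log δ / ((T : ℝ) - 2))) := by
  obtain ⟨k, rfl⟩ : ∃ k, T = k + 3 := ⟨T - 3, by omega⟩
  have hk : 1 ≤ k := by omega
  rw [← Chordal.val_eq k hk δ]
  simp only [Chordal.det_eq k B hB]
  refine Chordal.haar_prob k μ (fun j => WithLp.toLp 2 fun i => B i j) ?_ δ hδ0 hδ1
  rw [orthonormal_iff_ite]
  intro i j
  have h : (Bᴴ * B) i j = (1 : Matrix (Fin 2) (Fin 2) ℂ) i j := by rw [hB]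
  rw [Matrix.one_apply] at h
  rw [← h, PiLp.inner_apply]
  simp [Matrix.mul_apply, mul_comm]
end

section
/- Let T ≥ 4 be an integer and fix B ∈ ℂ^{T×2} with B^H B = I_2. Let μ be the Haar probability measure on U(T). Then the pushforward of μ under the map U ↦ det(I_2 − B^H (UE)(UE)^H B) is the measure on ℝ having density f_2(x;T) = (1/2)(T−1)(T−2)²(T−3) x^{T−4} (1 − x² + 2x·log x) for x ∈ (0,1) and 0 elsewhere, with respect to Lebesgue measure on ℝ. -/
open Matrix MeasureTheory

section ChordalGaussian

open ProbabilityTheory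

lemma cp_map_stdGaussian {E F : Type*} [NormedAddCommGroup E] [InnerProductSpace ℝ E]
    [FiniteDimensional ℝ E] [MeasurableSpace E] [BorelSpace E]
    [NormedAddCommGroup F] [InnerProductSpace ℝ F]
    [FiniteDimensional ℝ F] [MeasurableSpace F] [BorelSpace F]
    (L : E → F) (hL : Continuous L) (i : F → E) (hi : ∀ t, ‖i t‖ = ‖t‖)
    (hadj : ∀ x t, inner ℝ (L x) t = inner ℝ x (i t)) :
    (stdGaussian E).map L = stdGaussian F := by
  have hm : Measurable L := hL.measurable
  have : IsProbabilityMeasure ((stdGaussian E).map L) :=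
    Measure.isProbabilityMeasure_map hm.aemeasurable
  apply Measure.ext_of_charFun
  ext t
  rw [charFun_stdGaussian, charFun_apply, integral_map hm.aemeasurable
    (Measurable.aestronglyMeasurable (by fun_prop))]
  simp_rw [hadj]
  rw [← charFun_apply, charFun_stdGaussian, hi]

lemma cp_stdGaussian_density (E : Type*) [NormedAddCommGroup E] [InnerProductSpace ℝ E]
    [FiniteDimensional ℝ E] [MeasurableSpace E] [BorelSpace E] :
    stdGaussian E = (volume : Measure E).withDensity (fun v => ENNReal.ofReal
      ((∫ v : E, Real.exp (-(1/2) * ‖v‖ ^ 2))⁻¹ * Real.exp (-(1/2) * ‖v‖ ^ 2))) := by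
  have hZ := GaussianFourier.integral_rexp_neg_mul_sq_norm (V := E) (b := 1/2) (by norm_num)
  set Z := ∫ v : E, Real.exp (-(1/2) * ‖v‖ ^ 2) with hZdef
  have hZpos : 0 < Z := by rw [hZ]; positivity
  have hintg : Integrable (fun v : E => Z⁻¹ * Real.exp (-(1/2) * ‖v‖ ^ 2)) := by
    refine Integrable.const_mul ?_ _
    by_contra h
    rw [integral_undef h] at hZdef
    exact hZpos.ne' hZdef
  have : IsFiniteMeasure ((volume : Measure E).withDensity (fun v => ENNReal.ofReal
      (Z⁻¹ * Real.exp (-(1/2) * ‖v‖ ^ 2)))) :=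
    isFiniteMeasure_withDensity_ofReal hintg.2
  apply Measure.ext_of_charFun
  ext t
  rw [charFun_stdGaussian, charFun_apply, integral_withDensity_eq_integral_toReal_smul
    (by fun_prop) (by simp)]
  have hC := GaussianFourier.integral_cexp_neg_mul_sq_norm_add (V := E) (b := 1/2) (by norm_num)
    Complex.I t
  have hC0 := GaussianFourier.integral_cexp_neg_mul_sq_norm (V := E) (b := 1/2) (by norm_num)
  have hZC : (Z : ℂ) = ((Real.pi : ℂ) / (1/2)) ^ (Module.finrank ℝ E / 2 : ℂ) := by
    rw [← hC0, hZdef, ← integral_complex_ofReal]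
    congr 1
    ext v
    push_cast
    rfl
  rw [← hZC] at hC
  have : ∀ v : E, (ENNReal.ofReal (Z⁻¹ * Real.exp (-(1/2) * ‖v‖ ^ 2))).toReal •
      Complex.exp ((inner ℝ v t : ℝ) * Complex.I) =
      (Z : ℂ)⁻¹ * Complex.exp (-(1/2) * ‖v‖ ^ 2 + Complex.I * (inner ℝ t v : ℝ)) := by
    intro v
    rw [ENNReal.toReal_ofReal (by positivity), Complex.exp_add, real_inner_comm]
    rw [Complex.real_smul]
    push_cast
    ring_nf
  simp_rw [this]
  rw [integral_const_mul, hC, ← mul_assoc, inv_mul_cancel₀ (by exact_mod_cast hZpos.ne'), one_mul]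
  congr 1
  rw [Complex.I_sq]
  ring

lemma cp_moment (E : Type*) [NormedAddCommGroup E] [InnerProductSpace ℝ E]
    [FiniteDimensional ℝ E] [MeasurableSpace E] [BorelSpace E] [Nontrivial E] (k : ℕ) :
    ∫ x, ‖x‖ ^ (2 * k) ∂(stdGaussian E) =
      2 ^ k * Real.Gamma (Module.finrank ℝ E / 2 + k) / Real.Gamma (Module.finrank ℝ E / 2) := by
  have hZ := GaussianFourier.integral_rexp_neg_mul_sq_norm (V := E) (b := 1/2) (by norm_num)
  have hd : 0 < Module.finrank ℝ E := Module.finrank_pos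
  set d := Module.finrank ℝ E with hd'
  have hgen : ∀ k : ℕ, ∫ y in Set.Ioi (0:ℝ), y ^ (d - 1) •
      (y ^ (2 * k) * Real.exp (-(1/2) * y ^ 2)) =
      (1/2 : ℝ) ^ (-((d:ℝ)/2)) * 2 ^ k * (1/2) * Real.Gamma (d / 2 + k) := by
    intro k
    have h := integral_rpow_mul_exp_neg_mul_rpow (p := 2) (q := (d:ℝ) - 1 + 2 * k) (b := 1/2)
      (by norm_num)
      (by have : (1:ℝ) ≤ d := by exact_mod_cast hd
          have : (0:ℝ) ≤ k := by positivity
          linarith) (by norm_num)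
    have e1 : ((d:ℝ) - 1 + 2 * k + 1) / 2 = d / 2 + k := by ring
    have e2 : -((d:ℝ) - 1 + 2 * k + 1) / 2 = -((d:ℝ)/2) + -(k:ℝ) := by ring
    rw [e1, e2, Real.rpow_add (by norm_num)] at h
    have e3 : (1/2 : ℝ) ^ (-(k:ℝ)) = 2 ^ k := by
      rw [Real.rpow_neg (by norm_num), Real.rpow_natCast]; simp
    rw [e3] at h
    rw [← h]
    refine setIntegral_congr_fun measurableSet_Ioi (fun y hy => ?_)
    have hy : 0 < y := hy
    simp only [smul_eq_mul]
    have : y ^ ((d:ℝ) - 1 + 2 * k) = y ^ (d - 1) * y ^ (2 * k) := by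
      rw [Real.rpow_add hy, ← Nat.cast_one, ← Nat.cast_sub hd, Real.rpow_natCast]
      congr 1
      exact_mod_cast Real.rpow_natCast y (2 * k)
    rw [this]
    norm_num
    ring
  have hpol : ∀ k : ℕ, ∫ x : E, ‖x‖ ^ (2 * k) * Real.exp (-(1/2) * ‖x‖ ^ 2) =
      (d * (volume : Measure E).real (Metric.ball 0 1)) * ((1/2 : ℝ) ^ (-((d:ℝ)/2)) * 2 ^ k * (1/2) *
        Real.Gamma (d / 2 + k)) := by
    intro k
    have := integral_fun_norm_addHaar (volume : Measure E)
      (fun y : ℝ => y ^ (2 * k) * Real.exp (-(1/2) * y ^ 2))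
    rw [this, hgen]
    simp only [nsmul_eq_mul, smul_eq_mul]
    ring
  have h0 := hpol 0
  simp only [mul_zero, pow_zero, one_mul, Nat.cast_zero, add_zero] at h0
  rw [cp_stdGaussian_density, integral_withDensity_eq_integral_toReal_smul
    (by fun_prop) (by simp)]
  set Z := ∫ v : E, Real.exp (-(1/2) * ‖v‖ ^ 2) with hZdef
  have hZpos : 0 < Z := by rw [hZ]; positivity
  have : ∀ v : E, (ENNReal.ofReal (Z⁻¹ * Real.exp (-(1/2) * ‖v‖ ^ 2))).toReal • ‖v‖ ^ (2 * k) =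
      Z⁻¹ * (‖v‖ ^ (2 * k) * Real.exp (-(1/2) * ‖v‖ ^ 2)) := by
    intro v
    rw [ENNReal.toReal_ofReal (by positivity), smul_eq_mul]
    ring
  simp_rw [this]
  rw [integral_const_mul, hpol, h0]
  have hG : 0 < Real.Gamma ((d:ℝ) / 2) := Real.Gamma_pos_of_pos (by positivity)
  rw [h0] at hZpos
  have h1 : (d * (volume : Measure E).real (Metric.ball 0 1)) ≠ 0 := left_ne_zero_of_mul hZpos.ne'
  have h2 : (1/2 : ℝ) ^ (-((d:ℝ)/2)) ≠ 0 := by positivity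
  generalize (d * (volume : Measure E).real (Metric.ball 0 1)) = a at *
  generalize (1/2 : ℝ) ^ (-((d:ℝ)/2)) = b at *
  field_simp

end ChordalGaussian

section ChordalGram

open ProbabilityTheory

attribute [local instance] InnerProductSpace.complexToReal

/-- Gram determinant of two vectors. -/
noncomputable def cpGram {H : Type*} [NormedAddCommGroup H] [InnerProductSpace ℂ H] (g h : H) : ℝ :=
  ‖g‖ ^ 2 * ‖h‖ ^ 2 - ‖inner ℂ g h‖ ^ 2

lemma cpGram_nonneg {H : Type*} [NormedAddCommGroup H] [InnerProductSpace ℂ H] (g h : H) :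
    0 ≤ cpGram g h := by
  unfold cpGram
  have := norm_inner_le_norm (𝕜 := ℂ) g h
  have h2 := pow_le_pow_left₀ (norm_nonneg _) this 2
  rw [mul_pow] at h2
  linarith

lemma cpGram_le {H : Type*} [NormedAddCommGroup H] [InnerProductSpace ℂ H] (g h : H) :
    cpGram g h ≤ ‖g‖ ^ 2 * ‖h‖ ^ 2 := by
  unfold cpGram
  have : 0 ≤ ‖inner ℂ g h‖ ^ 2 := by positivity
  linarith

/-- The even moments of a standard complex Gaussian. -/
noncomputable def cpM (n k : ℕ) : ℝ := 2 ^ k * Real.Gamma (n + k) / Real.Gamma n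

lemma cpM_pos (n k : ℕ) (hn : 0 < n) : 0 < cpM n k := by
  unfold cpM
  have h1 : 0 < Real.Gamma (n + k) := Real.Gamma_pos_of_pos (by positivity)
  have h2 : 0 < Real.Gamma n := Real.Gamma_pos_of_pos (by positivity)
  positivity

lemma cp_moment_complex (H : Type*) [NormedAddCommGroup H] [InnerProductSpace ℂ H]
    [FiniteDimensional ℂ H] [MeasurableSpace H] [BorelSpace H] (n : ℕ) (hn : 0 < n)
    (hH : Module.finrank ℂ H = n) (k : ℕ) :
    ∫ x, ‖x‖ ^ (2 * k) ∂(stdGaussian H) = cpM n k := by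
  have : Nontrivial H := Module.nontrivial_of_finrank_pos (R := ℂ) (by omega)
  rw [cp_moment]
  have : Module.finrank ℝ H = 2 * n := by
    rw [← hH]; exact finrank_real_of_complex H
  rw [this, cpM]
  have e : ((2 * n : ℕ) : ℝ) / 2 = n := by push_cast; ring
  rw [e]

lemma cpGram_proj {H : Type*} [NormedAddCommGroup H] [InnerProductSpace ℂ H]
    [FiniteDimensional ℂ H] (g h : H) (hg : g ≠ 0) :
    cpGram g h = ‖g‖ ^ 2 * ‖(ℂ ∙ g)ᗮ.orthogonalProjectionOnto h‖ ^ 2 := by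
  have h1 := Submodule.norm_sq_eq_add_norm_sq_projection h (ℂ ∙ g)
  have h2 : ‖(ℂ ∙ g).orthogonalProjectionOnto h‖ ^ 2 * ‖g‖ ^ 2 = ‖inner ℂ g h‖ ^ 2 := by
    have : (((ℂ ∙ g).orthogonalProjectionOnto h : (ℂ ∙ g)) : H) = (inner ℂ g h / ((‖g‖ ^ 2 : ℝ) : ℂ)) • g :=
      Submodule.starProjection_singleton ℂ h
    rw [Submodule.coe_norm, this, norm_smul, norm_div]
    have hg' : ‖g‖ ≠ 0 := by simpa using hg
    simp
    field_simp
  unfold cpGram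
  rw [← h2, h1]
  ring

lemma cp_J (H : Type*) [NormedAddCommGroup H] [InnerProductSpace ℂ H]
    [FiniteDimensional ℂ H] [MeasurableSpace H] [BorelSpace H] (n : ℕ) (hn : 0 < n)
    (hH : Module.finrank ℂ H = n + 1) (k : ℕ) :
    ∫ g, ∫ h, cpGram g h ^ k ∂(stdGaussian H) ∂(stdGaussian H) = cpM (n + 1) k * cpM n k := by
  have key : ∀ g : H, ∫ h, cpGram g h ^ k ∂(stdGaussian H) = ‖g‖ ^ (2 * k) * cpM n k := by
    intro g
    by_cases hg : g = 0
    · subst hg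
      rcases Nat.eq_zero_or_pos k with rfl | hk
      · have : Real.Gamma n ≠ 0 := (Real.Gamma_pos_of_pos (by positivity)).ne'
        simp [cpM, this]
      · simp [cpGram, hk.ne']
    · set K := (ℂ ∙ g)ᗮ with hK
      have hKd : Module.finrank ℂ K = n := by
        have := Fact.mk hH
        exact Submodule.finrank_orthogonal_span_singleton (n := n) hg
      have hmap : (stdGaussian H).map (fun h => K.orthogonalProjectionOnto h) = stdGaussian K := by
        refine cp_map_stdGaussian _ (by fun_prop) (fun t => (t : H)) (fun t => rfl) ?_
        intro x t
        change (inner ℂ _ _ : ℂ).re = (inner ℂ _ _ : ℂ).re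
        rw [Submodule.inner_orthogonalProjectionOnto_eq_of_mem_right]
      have hm := cp_moment_complex K n hn hKd k
      rw [← hmap, integral_map (by fun_prop) (by fun_prop)] at hm
      rw [← hm, ← integral_const_mul]
      congr 1
      ext h
      rw [cpGram_proj g h hg, mul_pow, ← pow_mul, ← pow_mul]
  simp_rw [key]
  rw [integral_mul_const, cp_moment_complex H (n+1) (by omega) hH]

end ChordalGram

section ChordalMatrix

/-- A column of a matrix as a vector of the Euclidean space. -/
noncomputable def cpCol {a : ℕ} (G : Matrix (Fin a) (Fin 2) ℂ) (j : Fin 2) :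
    EuclideanSpace ℂ (Fin a) := WithLp.toLp 2 (fun i => G i j)

lemma cpCol_inner {a : ℕ} (G : Matrix (Fin a) (Fin 2) ℂ) (i j : Fin 2) :
    inner ℂ (cpCol G i) (cpCol G j) = (Gᴴ * G) i j := by
  simp [cpCol, EuclideanSpace.inner_eq_star_dotProduct, Matrix.mul_apply, dotProduct, mul_comm]

lemma cpGram_det {a : ℕ} (G : Matrix (Fin a) (Fin 2) ℂ) :
    ((cpGram (cpCol G 0) (cpCol G 1) : ℝ) : ℂ) = (Gᴴ * G).det := by
  rw [Matrix.det_fin_two, ← cpCol_inner, ← cpCol_inner, ← cpCol_inner, ← cpCol_inner, cpGram]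
  rw [inner_self_eq_norm_sq_to_K, inner_self_eq_norm_sq_to_K, ← inner_conj_symm (cpCol G 1)]
  rw [Complex.mul_conj, Complex.normSq_eq_norm_sq]
  push_cast
  rfl

/-- Delete the first two rows. -/
def cpTail {n : ℕ} (G : Matrix (Fin (n + 2)) (Fin 2) ℂ) : Matrix (Fin n) (Fin 2) ℂ :=
  Matrix.of fun i j => G i.succ.succ j

lemma cpTail_mul {n : ℕ} (G : Matrix (Fin (n + 2)) (Fin 2) ℂ) (R : Matrix (Fin 2) (Fin 2) ℂ) :
    cpTail (G * R) = cpTail G * R := by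
  ext i j
  simp [cpTail, Matrix.mul_apply]

lemma cpTail_gram {n : ℕ} (G : Matrix (Fin (n + 2)) (Fin 2) ℂ) :
    (cpTail G)ᴴ * cpTail G =
      Gᴴ * G - Gᴴ * stdFrame (n + 2) 2 * (stdFrame (n + 2) 2)ᴴ * G := by
  ext i j
  have h1 : ∀ l : Fin 2, (Gᴴ * stdFrame (n + 2) 2) i l = star (G (Fin.castLE (by omega) l) i) := by
    intro l
    fin_cases l <;>
      simp [Matrix.mul_apply, stdFrame, Fin.sum_univ_succ]; rfl
  have h2 : ∀ l : Fin 2, ((stdFrame (n + 2) 2)ᴴ * G) l j = G (Fin.castLE (by omega) l) j := by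
    intro l
    fin_cases l <;>
      simp [Matrix.mul_apply, stdFrame, Fin.sum_univ_succ]; rfl
  rw [Matrix.mul_assoc (Gᴴ * stdFrame (n + 2) 2), Matrix.sub_apply,
    Matrix.mul_apply (M := Gᴴ * stdFrame (n + 2) 2)]
  simp only [h1, h2]
  simp [Matrix.mul_apply, Fin.sum_univ_succ, cpTail]

lemma cpTail_scale {n : ℕ} (G : Matrix (Fin (n + 2)) (Fin 2) ℂ) (R : Matrix (Fin 2) (Fin 2) ℂ) :
    cpGram (cpCol (cpTail (G * R)) 0) (cpCol (cpTail (G * R)) 1) =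
      ‖R.det‖ ^ 2 * cpGram (cpCol (cpTail G) 0) (cpCol (cpTail G) 1) := by
  have : ((cpGram (cpCol (cpTail (G * R)) 0) (cpCol (cpTail (G * R)) 1) : ℝ) : ℂ) =
      ((‖R.det‖ ^ 2 * cpGram (cpCol (cpTail G) 0) (cpCol (cpTail G) 1) : ℝ) : ℂ) := by
    push_cast
    rw [cpGram_det, cpGram_det, cpTail_mul, conjTranspose_mul]
    have : Rᴴ * (cpTail G)ᴴ * (cpTail G * R) = Rᴴ * ((cpTail G)ᴴ * cpTail G) * R := by
      simp only [Matrix.mul_assoc]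
    rw [this, Matrix.det_mul, Matrix.det_mul, Matrix.det_conjTranspose, ← Complex.ofReal_pow,
      ← Complex.normSq_eq_norm_sq, ← Complex.mul_conj]
    simp only [RCLike.star_def]
    ring
  exact_mod_cast this

lemma cp_exists_unitary {T : ℕ} (hT : 2 ≤ T) (Q : Matrix (Fin T) (Fin 2) ℂ) (hQ : Qᴴ * Q = 1) :
    ∃ W : Matrix.unitaryGroup (Fin T) ℂ, (W : Matrix (Fin T) (Fin T) ℂ) * stdFrame T 2 = Q := by
  let v : Fin T → EuclideanSpace ℂ (Fin T) := fun j => if h : (j : ℕ) < 2 then cpCol Q ⟨j, h⟩ else 0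
  let s : Set (Fin T) := {j | (j : ℕ) < 2}
  have hv : Orthonormal ℂ (s.domRestrict v) := by
    rw [orthonormal_iff_ite]
    rintro ⟨i, hi⟩ ⟨j, hj⟩
    have hi' : (i : ℕ) < 2 := hi
    have hj' : (j : ℕ) < 2 := hj
    simp only [Set.domRestrict_apply, v, hi', hj', dif_pos]
    rw [cpCol_inner, hQ, Matrix.one_apply]
    simp [Fin.ext_iff]
  obtain ⟨b, hb⟩ := hv.exists_orthonormalBasis_extension_of_card_eq (by simp)
  let W : Matrix (Fin T) (Fin T) ℂ := Matrix.of fun i j => b j i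
  have hW : W ∈ Matrix.unitaryGroup (Fin T) ℂ := by
    rw [Matrix.mem_unitaryGroup_iff']
    ext i j
    have := orthonormal_iff_ite.mp b.orthonormal i j
    rw [Matrix.one_apply, ← this, EuclideanSpace.inner_eq_star_dotProduct]
    simp [W, Matrix.mul_apply, dotProduct, mul_comm, Matrix.star_apply]
  refine ⟨⟨W, hW⟩, ?_⟩
  ext i j
  have hj : (j : ℕ) < T := by omega
  have h1 : (W * stdFrame T 2) i j = W i ⟨j, hj⟩ := by
    rw [Matrix.mul_apply, Finset.sum_eq_single ⟨j, hj⟩]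
    · simp [stdFrame]
    · intro l _ hl
      have : (l : ℕ) ≠ j := fun h => hl (Fin.ext h)
      simp [stdFrame, this]
    · simp
  rw [h1]
  have h2 := hb ⟨j, hj⟩ (show (j : ℕ) < 2 from j.2)
  simp only [W, Matrix.of_apply, h2, v]
  rw [dif_pos j.2]
  rfl

lemma cp_exists_unitary' {T : ℕ} (hT : 2 ≤ T) (B Q : Matrix (Fin T) (Fin 2) ℂ) (hB : Bᴴ * B = 1)
    (hQ : Qᴴ * Q = 1) :
    ∃ W : Matrix.unitaryGroup (Fin T) ℂ, (W : Matrix (Fin T) (Fin T) ℂ) * B = Q := by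
  obtain ⟨W₁, h₁⟩ := cp_exists_unitary hT B hB
  obtain ⟨W₂, h₂⟩ := cp_exists_unitary hT Q hQ
  refine ⟨W₂ * W₁⁻¹, ?_⟩
  have : ((W₁⁻¹ : Matrix.unitaryGroup (Fin T) ℂ) : Matrix (Fin T) (Fin T) ℂ) *
      (W₁ : Matrix (Fin T) (Fin T) ℂ) = 1 := by
    rw [← Submonoid.coe_mul, inv_mul_cancel, Submonoid.coe_one]
  rw [← h₁, ← h₂, Submonoid.coe_mul, Matrix.mul_assoc, ← Matrix.mul_assoc _ _ (stdFrame T 2),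
    this, Matrix.one_mul]

lemma cp_exists_factor {T : ℕ} (G : Matrix (Fin T) (Fin 2) ℂ) (hG : (Gᴴ * G).det ≠ 0) :
    ∃ (Q : Matrix (Fin T) (Fin 2) ℂ) (R : Matrix (Fin 2) (Fin 2) ℂ),
      Qᴴ * Q = 1 ∧ G = Q * R ∧ (Gᴴ * G).det = ((‖R.det‖ ^ 2 : ℝ) : ℂ) := by
  obtain ⟨R, hR⟩ : ∃ R : Matrix (Fin 2) (Fin 2) ℂ, Gᴴ * G = Rᴴ * R := by
    open scoped MatrixOrder ComplexOrder in
    exact CStarAlgebra.nonneg_iff_eq_star_mul_self.mp (Matrix.posSemidef_conjTranspose_mul_self G).nonneg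
  have hdet : (Gᴴ * G).det = ((‖R.det‖ ^ 2 : ℝ) : ℂ) := by
    rw [hR, Matrix.det_mul, Matrix.det_conjTranspose, 
      ← Complex.normSq_eq_norm_sq, ← Complex.mul_conj, mul_comm]
    rfl
  have hu : IsUnit R.det := by
    rw [isUnit_iff_ne_zero]
    intro h
    rw [h] at hdet
    simp at hdet
    exact hG hdet
  refine ⟨G * R⁻¹, R, ?_, ?_, hdet⟩
  · have huH : IsUnit (Rᴴ).det := by rw [Matrix.det_conjTranspose]; exact hu.star
    rw [conjTranspose_mul, Matrix.mul_assoc, ← Matrix.mul_assoc Gᴴ, hR, Matrix.mul_assoc,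
      Matrix.mul_nonsing_inv _ hu, Matrix.mul_one, Matrix.conjTranspose_nonsing_inv,
      Matrix.nonsing_inv_mul _ huH]
  · rw [Matrix.mul_assoc, Matrix.nonsing_inv_mul _ hu, Matrix.mul_one]

lemma cp_degenerate {n : ℕ} (G : Matrix (Fin (n + 2)) (Fin 2) ℂ) (hG : (Gᴴ * G).det = 0)
    (A : Matrix (Fin (n + 2)) (Fin (n + 2)) ℂ) :
    cpGram (cpCol (cpTail (A * G)) 0) (cpCol (cpTail (A * G)) 1) = 0 := by
  obtain ⟨v, hv, h⟩ := Matrix.exists_mulVec_eq_zero_iff.mpr hG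
  have hGv : G *ᵥ v = 0 := by
    open scoped ComplexOrder in
    exact Matrix.conjTranspose_mul_self_mulVec_eq_zero G v |>.mp h
  have : ((cpTail (A * G))ᴴ * cpTail (A * G)).det = 0 := by
    apply Matrix.exists_mulVec_eq_zero_iff.mp
    refine ⟨v, hv, ?_⟩
    have h2 : cpTail (A * G) *ᵥ v = 0 := by
      have h3 : (A * G) *ᵥ v = 0 := by rw [← Matrix.mulVec_mulVec, hGv, Matrix.mulVec_zero]
      ext i
      exact congrFun h3 i.succ.succ
    rw [← Matrix.mulVec_mulVec, h2, Matrix.mulVec_zero]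
  rw [← cpGram_det] at this
  exact_mod_cast this

instance cpBorelMatrix {m n : ℕ} : BorelSpace (Matrix (Fin m) (Fin n) ℂ) :=
  inferInstanceAs (BorelSpace (Fin m → Fin n → ℂ))

lemma cp_invariance {n : ℕ} (μ : Measure (Matrix.unitaryGroup (Fin (n + 2)) ℂ))
    [IsProbabilityMeasure μ] [μ.IsMulLeftInvariant]
    (B : Matrix (Fin (n + 2)) (Fin 2) ℂ) (hB : Bᴴ * B = 1) (k : ℕ)
    (G : Matrix (Fin (n + 2)) (Fin 2) ℂ) :
    ∫ U : Matrix.unitaryGroup (Fin (n + 2)) ℂ,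
      cpGram (cpCol (cpTail ((U : Matrix (Fin (n + 2)) (Fin (n + 2)) ℂ)ᴴ * G)) 0)
        (cpCol (cpTail ((U : Matrix (Fin (n + 2)) (Fin (n + 2)) ℂ)ᴴ * G)) 1) ^ k ∂μ =
    (∫ U : Matrix.unitaryGroup (Fin (n + 2)) ℂ,
      cpGram (cpCol (cpTail ((U : Matrix (Fin (n + 2)) (Fin (n + 2)) ℂ)ᴴ * B)) 0)
        (cpCol (cpTail ((U : Matrix (Fin (n + 2)) (Fin (n + 2)) ℂ)ᴴ * B)) 1) ^ k ∂μ) *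
      cpGram (cpCol G 0) (cpCol G 1) ^ k := by
  rcases Nat.eq_zero_or_pos k with rfl | hk
  · simp
  by_cases hG : (Gᴴ * G).det = 0
  · have h0 : cpGram (cpCol G 0) (cpCol G 1) = 0 := by
      have := cpGram_det G
      rw [hG] at this
      exact_mod_cast this
    simp_rw [cp_degenerate G hG, h0]
    simp [hk.ne']
  · obtain ⟨Q, R, hQ, hGQ, hdet⟩ := cp_exists_factor G hG
    have hD : cpGram (cpCol G 0) (cpCol G 1) = ‖R.det‖ ^ 2 := by
      rw [← cpGram_det] at hdet
      exact_mod_cast hdet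
    obtain ⟨V, hV⟩ := cp_exists_unitary' (by omega) B Q hB hQ
    rw [hD, ← integral_mul_const]
    rw [← integral_mul_left_eq_self (μ := μ) _ V]
    congr 1
    ext U
    rw [hGQ, ← Matrix.mul_assoc, cpTail_scale, mul_pow, mul_comm]
    have e : (((V * U : Matrix.unitaryGroup (Fin (n + 2)) ℂ)) :
        Matrix (Fin (n + 2)) (Fin (n + 2)) ℂ)ᴴ * Q =
        (U : Matrix (Fin (n + 2)) (Fin (n + 2)) ℂ)ᴴ * B := by
      have hVV : (V : Matrix (Fin (n + 2)) (Fin (n + 2)) ℂ)ᴴ * V = 1 :=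
        Matrix.mem_unitaryGroup_iff'.mp V.2
      rw [← hV, Submonoid.coe_mul, conjTranspose_mul, Matrix.mul_assoc, ← Matrix.mul_assoc _ _ B,
        hVV, Matrix.one_mul]
    rw [e]

end ChordalMatrix

section ChordalSwap

open ProbabilityTheory

attribute [local instance] InnerProductSpace.complexToReal

/-- The matrix with two given columns. -/
def cpMat {a : ℕ} (g h : EuclideanSpace ℂ (Fin a)) : Matrix (Fin a) (Fin 2) ℂ :=
  Matrix.of fun i j => if j = 0 then g i else h i

/-- The map `x ↦ (last n coordinates of Aᴴ x)`. -/
noncomputable def cpL {n : ℕ} (A : Matrix (Fin (n + 2)) (Fin (n + 2)) ℂ)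
    (x : EuclideanSpace ℂ (Fin (n + 2))) : EuclideanSpace ℂ (Fin n) :=
  WithLp.toLp 2 (fun i => (Aᴴ *ᵥ x.ofLp) i.succ.succ)

/-- The adjoint of `cpL`. -/
noncomputable def cpLadj {n : ℕ} (A : Matrix (Fin (n + 2)) (Fin (n + 2)) ℂ)
    (t : EuclideanSpace ℂ (Fin n)) : EuclideanSpace ℂ (Fin (n + 2)) :=
  WithLp.toLp 2 (A *ᵥ (Fin.cons 0 (Fin.cons 0 t.ofLp : Fin (n + 1) → ℂ) : Fin (n + 2) → ℂ))

lemma cpL_inner {n : ℕ} (A : Matrix (Fin (n + 2)) (Fin (n + 2)) ℂ)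
    (x : EuclideanSpace ℂ (Fin (n + 2))) (t : EuclideanSpace ℂ (Fin n)) :
    inner ℂ (cpL A x) t = inner ℂ x (cpLadj A t) := by
  rw [EuclideanSpace.inner_eq_star_dotProduct, EuclideanSpace.inner_eq_star_dotProduct]
  unfold cpL cpLadj
  set s : Fin (n + 2) → ℂ := Fin.cons 0 (Fin.cons 0 t.ofLp : Fin (n + 1) → ℂ) with hs
  have h1 : (A *ᵥ s) ⬝ᵥ star x.ofLp = s ⬝ᵥ star (Aᴴ *ᵥ x.ofLp) := by
    rw [Matrix.star_mulVec, conjTranspose_conjTranspose, dotProduct_comm, Matrix.dotProduct_mulVec,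
      dotProduct_comm]
  rw [h1]
  simp [dotProduct, Fin.sum_univ_succ, hs]

lemma cpLadj_norm {n : ℕ} (U : Matrix.unitaryGroup (Fin (n + 2)) ℂ)
    (t : EuclideanSpace ℂ (Fin n)) :
    ‖cpLadj (U : Matrix (Fin (n + 2)) (Fin (n + 2)) ℂ) t‖ = ‖t‖ := by
  have h2 : inner ℂ (cpLadj (U : Matrix (Fin (n + 2)) (Fin (n + 2)) ℂ) t)
      (cpLadj (U : Matrix (Fin (n + 2)) (Fin (n + 2)) ℂ) t) = inner ℂ t t := by
    rw [← cpL_inner]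
    congr 1
    unfold cpL cpLadj
    have hU : (U : Matrix (Fin (n + 2)) (Fin (n + 2)) ℂ)ᴴ * U = 1 :=
        Matrix.mem_unitaryGroup_iff'.mp U.2
    simp only [Matrix.mulVec_mulVec, hU, Matrix.one_mulVec]
    ext i
    simp
  rw [inner_self_eq_norm_sq_to_K, inner_self_eq_norm_sq_to_K] at h2
  have h3 : ‖cpLadj (U : Matrix (Fin (n + 2)) (Fin (n + 2)) ℂ) t‖ ^ 2 = ‖t‖ ^ 2 := by
    exact_mod_cast h2
  exact (pow_left_inj₀ (norm_nonneg _) (norm_nonneg _) (by norm_num)).mp h3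

lemma cpL_norm_le {n : ℕ} (U : Matrix.unitaryGroup (Fin (n + 2)) ℂ)
    (x : EuclideanSpace ℂ (Fin (n + 2))) :
    ‖cpL (U : Matrix (Fin (n + 2)) (Fin (n + 2)) ℂ) x‖ ≤ ‖x‖ := by
  set y := cpL (U : Matrix (Fin (n + 2)) (Fin (n + 2)) ℂ) x with hy
  have h1 : ‖y‖ ^ 2 ≤ ‖x‖ * ‖y‖ := by
    have h := norm_inner_le_norm (𝕜 := ℂ) x (cpLadj (U : Matrix (Fin (n + 2)) (Fin (n + 2)) ℂ) y)
    rw [← cpL_inner, ← hy, cpLadj_norm, inner_self_eq_norm_sq_to_K] at h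
    simpa using h
  by_contra hlt
  push Not at hlt
  have := norm_nonneg x
  nlinarith

lemma cpL_continuous {n : ℕ} : Continuous (fun p : Matrix (Fin (n + 2)) (Fin (n + 2)) ℂ ×
    EuclideanSpace ℂ (Fin (n + 2)) => cpL p.1 p.2) := by
  unfold cpL Matrix.mulVec dotProduct
  fun_prop

lemma cpGram_continuous {H : Type*} [NormedAddCommGroup H] [InnerProductSpace ℂ H] :
    Continuous (fun p : H × H => cpGram p.1 p.2) := by
  unfold cpGram
  fun_prop

lemma cpCol_cpTail0 {n : ℕ} (A : Matrix (Fin (n + 2)) (Fin (n + 2)) ℂ)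
    (g h : EuclideanSpace ℂ (Fin (n + 2))) :
    cpCol (cpTail (Aᴴ * cpMat g h)) 0 = cpL A g := by
  ext i
  simp [cpCol, cpTail, cpL, cpMat, Matrix.mul_apply, Matrix.mulVec, dotProduct]

lemma cpCol_cpTail1 {n : ℕ} (A : Matrix (Fin (n + 2)) (Fin (n + 2)) ℂ)
    (g h : EuclideanSpace ℂ (Fin (n + 2))) :
    cpCol (cpTail (Aᴴ * cpMat g h)) 1 = cpL A h := by
  ext i
  simp [cpCol, cpTail, cpL, cpMat, Matrix.mul_apply, Matrix.mulVec, dotProduct]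

lemma cpMat_cpCol {n : ℕ} (G : Matrix (Fin n) (Fin 2) ℂ) : cpMat (cpCol G 0) (cpCol G 1) = G := by
  ext i j
  fin_cases j <;> simp [cpMat, cpCol]

lemma cp_norm_pow_integrable (H : Type*) [NormedAddCommGroup H] [InnerProductSpace ℂ H]
    [FiniteDimensional ℂ H] [MeasurableSpace H] [BorelSpace H] (k : ℕ) :
    Integrable (fun x : H => (‖x‖ ^ 2) ^ k) (stdGaussian H) := by
  have := (IsGaussian.memLp_id (stdGaussian H) ((2 * k : ℕ) : ENNReal) (ENNReal.natCast_ne_top _)).integrable_norm_pow'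
  simpa [pow_mul] using this

lemma cp_ck {m : ℕ} (hm : 0 < m) (μ : Measure (Matrix.unitaryGroup (Fin (m + 1 + 2)) ℂ))
    [IsProbabilityMeasure μ] [μ.IsMulLeftInvariant]
    (B : Matrix (Fin (m + 1 + 2)) (Fin 2) ℂ) (hB : Bᴴ * B = 1) (k : ℕ) :
    (∫ U : Matrix.unitaryGroup (Fin (m + 1 + 2)) ℂ,
      cpGram (cpCol (cpTail ((U : Matrix (Fin (m + 1 + 2)) (Fin (m + 1 + 2)) ℂ)ᴴ * B)) 0)
        (cpCol (cpTail ((U : Matrix (Fin (m + 1 + 2)) (Fin (m + 1 + 2)) ℂ)ᴴ * B)) 1) ^ k ∂μ) *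
      (cpM (m + 3) k * cpM (m + 2) k) = cpM (m + 1) k * cpM m k := by
  set c := ∫ U : Matrix.unitaryGroup (Fin (m + 1 + 2)) ℂ,
      cpGram (cpCol (cpTail ((U : Matrix (Fin (m + 1 + 2)) (Fin (m + 1 + 2)) ℂ)ᴴ * B)) 0)
        (cpCol (cpTail ((U : Matrix (Fin (m + 1 + 2)) (Fin (m + 1 + 2)) ℂ)ᴴ * B)) 1) ^ k ∂μ with hc
  set H := EuclideanSpace ℂ (Fin (m + 1 + 2)) with hH
  set γ := stdGaussian H with hγ
  let F : H × H → Matrix.unitaryGroup (Fin (m + 1 + 2)) ℂ → ℝ := fun z U =>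
    cpGram (cpL (U : Matrix (Fin (m + 1 + 2)) (Fin (m + 1 + 2)) ℂ) z.1)
      (cpL (U : Matrix (Fin (m + 1 + 2)) (Fin (m + 1 + 2)) ℂ) z.2) ^ k
  have hFcont : Continuous (Function.uncurry F) := by
    have h1 : Continuous (fun p : (H × H) × Matrix.unitaryGroup (Fin (m + 1 + 2)) ℂ =>
        cpL (p.2 : Matrix (Fin (m + 1 + 2)) (Fin (m + 1 + 2)) ℂ) p.1.1) :=
      cpL_continuous.comp (f := fun p : (H × H) × Matrix.unitaryGroup (Fin (m + 1 + 2)) ℂ =>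
        ((p.2 : Matrix (Fin (m + 1 + 2)) (Fin (m + 1 + 2)) ℂ), p.1.1)) (by fun_prop)
    have h2 : Continuous (fun p : (H × H) × Matrix.unitaryGroup (Fin (m + 1 + 2)) ℂ =>
        cpL (p.2 : Matrix (Fin (m + 1 + 2)) (Fin (m + 1 + 2)) ℂ) p.1.2) :=
      cpL_continuous.comp (f := fun p : (H × H) × Matrix.unitaryGroup (Fin (m + 1 + 2)) ℂ =>
        ((p.2 : Matrix (Fin (m + 1 + 2)) (Fin (m + 1 + 2)) ℂ), p.1.2)) (by fun_prop)
    exact (cpGram_continuous.comp (h1.prodMk h2)).pow k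
  have hbase : Integrable (fun z : H × H => (‖z.1‖ ^ 2) ^ k * (‖z.2‖ ^ 2) ^ k) (γ.prod γ) :=
    (cp_norm_pow_integrable H k).mul_prod (cp_norm_pow_integrable H k)
  have hFint : Integrable (Function.uncurry F) ((γ.prod γ).prod μ) := by
    refine (hbase.comp_fst μ).mono' hFcont.aestronglyMeasurable ?_
    refine Filter.Eventually.of_forall ?_
    rintro ⟨⟨g, h⟩, U⟩
    simp only [Function.uncurry, F]
    rw [Real.norm_of_nonneg (pow_nonneg (cpGram_nonneg _ _) _), ← mul_pow]
    refine pow_le_pow_left₀ (cpGram_nonneg _ _) ((cpGram_le _ _).trans ?_) _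
    have h1 := cpL_norm_le U g
    have h2 := cpL_norm_le U h
    gcongr
  have hDint : Integrable (fun z : H × H => cpGram z.1 z.2 ^ k) (γ.prod γ) := by
    refine hbase.mono' (cpGram_continuous.pow k).aestronglyMeasurable ?_
    refine Filter.Eventually.of_forall ?_
    rintro ⟨g, h⟩
    rw [Real.norm_of_nonneg (pow_nonneg (cpGram_nonneg _ _) _), ← mul_pow]
    exact pow_le_pow_left₀ (cpGram_nonneg _ _) (cpGram_le _ _) _
  have hswap := integral_integral_swap hFint
  have hleft : ∀ z : H × H, ∫ U, F z U ∂μ = c * cpGram z.1 z.2 ^ k := by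
    rintro ⟨g, h⟩
    have := cp_invariance μ B hB k (cpMat g h)
    rw [← hc] at this
    simp_rw [cpCol_cpTail0, cpCol_cpTail1] at this
    have e0 : cpCol (cpMat g h) 0 = g := by ext i; simp [cpCol, cpMat]
    have e1 : cpCol (cpMat g h) 1 = h := by ext i; simp [cpCol, cpMat]
    rw [e0, e1] at this
    exact this
  have hright : ∀ U, ∫ z, F z U ∂(γ.prod γ) = cpM (m + 1) k * cpM m k := by
    intro U
    have hLc : Continuous (cpL (U : Matrix (Fin (m + 1 + 2)) (Fin (m + 1 + 2)) ℂ)) :=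
      cpL_continuous.comp (f := fun x => ((U : Matrix (Fin (m + 1 + 2)) (Fin (m + 1 + 2)) ℂ), x))
        (by fun_prop)
    have hmap : γ.map (cpL (U : Matrix (Fin (m + 1 + 2)) (Fin (m + 1 + 2)) ℂ)) =
        stdGaussian (EuclideanSpace ℂ (Fin (m + 1))) := by
      refine cp_map_stdGaussian _ hLc (cpLadj U) (cpLadj_norm U) ?_
      intro x t
      change (inner ℂ _ _ : ℂ).re = (inner ℂ _ _ : ℂ).re
      rw [cpL_inner]
    have hJ := cp_J (EuclideanSpace ℂ (Fin (m + 1))) m hm (by simp) k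
    rw [← hJ, ← integral_prod (f := fun z : EuclideanSpace ℂ (Fin (m + 1)) ×
      EuclideanSpace ℂ (Fin (m + 1)) => cpGram z.1 z.2 ^ k), ← hmap,
      Measure.map_prod_map _ _ hLc.measurable hLc.measurable, integral_map]
    · rfl
    · exact (hLc.measurable.prodMap hLc.measurable).aemeasurable
    · exact (cpGram_continuous.pow k).aestronglyMeasurable
    · refine ((cp_norm_pow_integrable (EuclideanSpace ℂ (Fin (m + 1))) k).mul_prod
        (cp_norm_pow_integrable _ k)).mono' (cpGram_continuous.pow k).aestronglyMeasurable ?_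
      refine Filter.Eventually.of_forall ?_
      rintro ⟨g, h⟩
      rw [Real.norm_of_nonneg (pow_nonneg (cpGram_nonneg _ _) _), ← mul_pow]
      exact pow_le_pow_left₀ (cpGram_nonneg _ _) (cpGram_le _ _) _
  simp_rw [hleft, hright] at hswap
  rw [integral_const_mul, integral_prod _ hDint,
    cp_J H (m + 2) (by omega) (finrank_euclideanSpace_fin (𝕜 := ℂ) (n := m + 1 + 2)) k] at hswap
  simpa using hswap

end ChordalSwap

section ChordalFinal

lemma cp_ext_moments (μ ν : Measure ℝ) [IsFiniteMeasure μ] [IsFiniteMeasure ν]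
    (hμ : ∀ᵐ x ∂μ, x ∈ Set.Icc (0 : ℝ) 1) (hν : ∀ᵐ x ∂ν, x ∈ Set.Icc (0 : ℝ) 1)
    (h : ∀ k : ℕ, ∫ x, x ^ k ∂μ = ∫ x, x ^ k ∂ν) : μ = ν := by
  have hbdd : ∀ (ρ : Measure ℝ) [IsFiniteMeasure ρ], (∀ᵐ x ∂ρ, x ∈ Set.Icc (0 : ℝ) 1) →
      ∀ f : ℝ → ℝ, Continuous f → Integrable f ρ := by
    intro ρ _ hρ f hf
    obtain ⟨C, hC⟩ := isCompact_Icc.exists_bound_of_continuousOn (s := Set.Icc (0:ℝ) 1)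
      hf.continuousOn
    refine Integrable.of_bound hf.aestronglyMeasurable C ?_
    filter_upwards [hρ] with x hx using hC x hx
  have hpoly : ∀ p : Polynomial ℝ, ∫ x, p.eval x ∂μ = ∫ x, p.eval x ∂ν := by
    intro p
    simp_rw [Polynomial.eval_eq_sum_range]
    rw [integral_finsetSum, integral_finsetSum]
    · refine Finset.sum_congr rfl fun i _ => ?_
      rw [integral_const_mul, integral_const_mul, h]
    · intro i _
      exact hbdd ν hν _ (by fun_prop)
    · intro i _
      exact hbdd μ hμ _ (by fun_prop)
  apply ext_of_forall_integral_eq_of_IsFiniteMeasure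
  intro f
  have hfc : Continuous (fun x => f x) := f.continuous
  have happ : ∀ (ρ : Measure ℝ) [IsFiniteMeasure ρ], (∀ᵐ x ∂ρ, x ∈ Set.Icc (0 : ℝ) 1) →
      ∀ (p : Polynomial ℝ) (ε : ℝ), (∀ x ∈ Set.Icc (0:ℝ) 1, |p.eval x - f x| < ε) →
      |∫ x, p.eval x ∂ρ - ∫ x, f x ∂ρ| ≤ ε * ρ.real Set.univ := by
    intro ρ _ hρ p ε hp
    rw [← integral_sub (hbdd ρ hρ _ p.continuous) (hbdd ρ hρ _ hfc)]
    have hb : ∀ᵐ x ∂ρ, ‖p.eval x - f x‖ ≤ ε := by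
      filter_upwards [hρ] with x hx using (hp x hx).le
    exact norm_integral_le_of_norm_le_const (μ := ρ) hb
  by_contra hne
  have hpos : 0 < |∫ x, f x ∂μ - ∫ x, f x ∂ν| := abs_pos.mpr (sub_ne_zero.mpr hne)
  set d := |∫ x, f x ∂μ - ∫ x, f x ∂ν| with hd
  set M := μ.real Set.univ + ν.real Set.univ + 1 with hM
  have hM1 : 0 ≤ μ.real Set.univ := measureReal_nonneg
  have hM2 : 0 ≤ ν.real Set.univ := measureReal_nonneg
  have hMpos : 0 < M := by positivity
  obtain ⟨p, hp⟩ := exists_polynomial_near_of_continuousOn 0 1 f hfc.continuousOn (d / M)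
    (by positivity)
  have h1 := happ μ hμ p _ hp
  have h2 := happ ν hν p _ hp
  rw [hpoly p] at h1
  have h3 : d ≤ d / M * μ.real Set.univ + d / M * ν.real Set.univ := by
    have e : ∫ x, f x ∂μ - ∫ x, f x ∂ν = (∫ x, p.eval x ∂ν - ∫ x, f x ∂ν) -
      (∫ x, p.eval x ∂ν - ∫ x, f x ∂μ) := by ring
    have e2 := (congrArg abs e).trans_le (abs_sub _ _)
    rw [← hd] at e2
    linarith
  have h4 : d / M * μ.real Set.univ + d / M * ν.real Set.univ = d - d / M := by
    field_simp
    rw [hM]; ring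
  have : 0 < d / M := by positivity
  linarith

lemma cp_density_integral (n : ℕ) :
    ∫ x in (0:ℝ)..1, x ^ n * (1 - x ^ 2 + 2 * x * Real.log x) =
      2 / (((n:ℝ) + 1) * ((n:ℝ) + 2) ^ 2 * ((n:ℝ) + 3)) := by
  have hc : Continuous (fun x : ℝ => x ^ n * (1 - x ^ 2 + 2 * x * Real.log x)) := by
    have h := Real.continuous_mul_log
    have : (fun x : ℝ => x ^ n * (1 - x ^ 2 + 2 * x * Real.log x)) =
      fun x : ℝ => x ^ n * (1 - x ^ 2 + 2 * (x * Real.log x)) := by ext x; ring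
    rw [this]
    fun_prop
  have hA : Continuous (fun x : ℝ => x ^ (n + 1) / ((n:ℝ) + 1) - x ^ (n + 3) / ((n:ℝ) + 3) +
      2 * (x ^ (n + 1) * (x * Real.log x) / ((n:ℝ) + 2) - x ^ (n + 2) / ((n:ℝ) + 2) ^ 2)) := by
    have h := Real.continuous_mul_log
    fun_prop
  have hder : ∀ x ∈ Set.Ioo (0:ℝ) 1, HasDerivAt
      (fun x : ℝ => x ^ (n + 1) / ((n:ℝ) + 1) - x ^ (n + 3) / ((n:ℝ) + 3) +
      2 * (x ^ (n + 1) * (x * Real.log x) / ((n:ℝ) + 2) - x ^ (n + 2) / ((n:ℝ) + 2) ^ 2))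
      (x ^ n * (1 - x ^ 2 + 2 * x * Real.log x)) x := by
    intro x hx
    have hx0 : x ≠ 0 := hx.1.ne'
    have hl := Real.hasDerivAt_mul_log hx0
    have h1 := (hasDerivAt_pow (n + 1) x)
    have h2 := (hasDerivAt_pow (n + 2) x)
    have h3 := (hasDerivAt_pow (n + 3) x)
    have := ((h1.div_const ((n:ℝ) + 1)).sub (h3.div_const ((n:ℝ) + 3))).add
      ((((h1.mul hl).div_const ((n:ℝ) + 2)).sub (h2.div_const (((n:ℝ) + 2) ^ 2))).const_mul 2)
    refine this.congr_deriv ?_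
    have a1 : (n:ℝ) + 1 ≠ 0 := by positivity
    have a2 : (n:ℝ) + 2 ≠ 0 := by positivity
    have a3 : (n:ℝ) + 3 ≠ 0 := by positivity
    push_cast
    try simp only [Nat.add_sub_cancel, show n + 3 - 1 = n + 2 by omega, show n + 2 - 1 = n + 1 by omega]
    field_simp
    ring
  rw [intervalIntegral.integral_eq_sub_of_hasDerivAt_of_le zero_le_one hA.continuousOn hder
    (hc.intervalIntegrable _ _)]
  have a1 : (n:ℝ) + 1 ≠ 0 := by positivity
  have a2 : (n:ℝ) + 2 ≠ 0 := by positivity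
  have a3 : (n:ℝ) + 3 ≠ 0 := by positivity
  simp
  field_simp
  ring

lemma cp_log_ineq (x : ℝ) (hx : x ∈ Set.Ioo (0:ℝ) 1) : 0 ≤ 1 - x ^ 2 + 2 * x * Real.log x := by
  have h0 : 0 ≤ -Real.log x := by
    have := Real.log_nonpos hx.1.le hx.2.le
    linarith
  have h := Real.self_le_sinh_iff.mpr h0
  rw [Real.sinh_eq, neg_neg, Real.exp_log hx.1, Real.exp_neg, Real.exp_log hx.1] at h
  have hx0 := hx.1
  have h2 := mul_le_mul_of_nonneg_left h (by positivity : 0 ≤ 2 * x)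
  have e : 2 * x * ((x⁻¹ - x) / 2) = 1 - x ^ 2 := by field_simp
  rw [e] at h2
  linarith

lemma cpM_ratio (n k : ℕ) (hn : 0 < n) :
    cpM (n + 2) k * (((n:ℝ) + 1) * n) = cpM n k * (((n:ℝ) + k + 1) * (n + k)) := by
  unfold cpM
  have hn' : (0:ℝ) < n := by exact_mod_cast hn
  have hG : Real.Gamma n ≠ 0 := (Real.Gamma_pos_of_pos hn').ne'
  have h1 : Real.Gamma ((n + 2 : ℕ) : ℝ) = ((n:ℝ) + 1) * (n * Real.Gamma n) := by
    push_cast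
    rw [show (n:ℝ) + 2 = (n + 1) + 1 by ring, Real.Gamma_add_one (by positivity),
      Real.Gamma_add_one (by positivity)]
  have h2 : Real.Gamma (((n + 2 : ℕ) : ℝ) + k) =
      ((n:ℝ) + k + 1) * ((n + k) * Real.Gamma (n + k)) := by
    push_cast
    rw [show (n:ℝ) + 2 + k = (n + k + 1) + 1 by ring, Real.Gamma_add_one (by positivity),
      Real.Gamma_add_one (by positivity)]
  rw [h1, h2]
  field_simp

set_option maxHeartbeats 1000000 in
lemma cp_main (r : ℕ)
    (B : Matrix (Fin (r + 4)) (Fin 2) ℂ) (hB : Bᴴ * B = 1)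
    (μ : Measure (Matrix.unitaryGroup (Fin (r + 4)) ℂ))
    [IsProbabilityMeasure μ] [μ.IsMulLeftInvariant] :
    μ.map (fun U : Matrix.unitaryGroup (Fin (r + 4)) ℂ =>
        ((1 - Bᴴ * ((U : Matrix (Fin (r + 4)) (Fin (r + 4)) ℂ) * stdFrame (r + 4) 2) *
            ((U : Matrix (Fin (r + 4)) (Fin (r + 4)) ℂ) * stdFrame (r + 4) 2)ᴴ * B).det).re)
      = volume.withDensity (fun x : ℝ =>
          ENNReal.ofReal (if x ∈ Set.Ioo (0 : ℝ) 1 then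
            (1 / 2) * ((r : ℝ) + 3) * ((r : ℝ) + 2) ^ 2 * ((r : ℝ) + 1) * x ^ r *
              (1 - x ^ 2 + 2 * x * Real.log x)
          else 0)) := by
  have hf : ∀ U : Matrix.unitaryGroup (Fin (r + 4)) ℂ,
      ((1 - Bᴴ * ((U : Matrix (Fin (r + 4)) (Fin (r + 4)) ℂ) * stdFrame (r + 4) 2) *
            ((U : Matrix (Fin (r + 4)) (Fin (r + 4)) ℂ) * stdFrame (r + 4) 2)ᴴ * B).det).re =
      cpGram (cpCol (cpTail (n := r + 2) ((U : Matrix (Fin (r + 4)) (Fin (r + 4)) ℂ)ᴴ * B)) 0)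
        (cpCol (cpTail (n := r + 2) ((U : Matrix (Fin (r + 4)) (Fin (r + 4)) ℂ)ᴴ * B)) 1) := by
    intro U
    have hU : (U : Matrix (Fin (r + 4)) (Fin (r + 4)) ℂ) *
        (U : Matrix (Fin (r + 4)) (Fin (r + 4)) ℂ)ᴴ = 1 := Matrix.mem_unitaryGroup_iff.mp U.2
    have h1 := cpTail_gram (n := r + 2) ((U : Matrix (Fin (r + 4)) (Fin (r + 4)) ℂ)ᴴ * B)
    have h2 : (1 : Matrix (Fin 2) (Fin 2) ℂ) -
        Bᴴ * ((U : Matrix (Fin (r + 4)) (Fin (r + 4)) ℂ) * stdFrame (r + 4) 2) *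
            ((U : Matrix (Fin (r + 4)) (Fin (r + 4)) ℂ) * stdFrame (r + 4) 2)ᴴ * B =
        (cpTail (n := r + 2) ((U : Matrix (Fin (r + 4)) (Fin (r + 4)) ℂ)ᴴ * B))ᴴ *
          cpTail (n := r + 2) ((U : Matrix (Fin (r + 4)) (Fin (r + 4)) ℂ)ᴴ * B) := by
      rw [h1, conjTranspose_mul (U : Matrix (Fin (r + 4)) (Fin (r + 4)) ℂ)ᴴ B, conjTranspose_conjTranspose]
      have g1 : Bᴴ * (U : Matrix (Fin (r + 4)) (Fin (r + 4)) ℂ) *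
          ((U : Matrix (Fin (r + 4)) (Fin (r + 4)) ℂ)ᴴ * B) = 1 := by
        rw [Matrix.mul_assoc, ← Matrix.mul_assoc _ _ B, hU, Matrix.one_mul, hB]
      rw [g1]
      simp only [conjTranspose_mul, Matrix.mul_assoc]
    rw [h2, ← cpGram_det, Complex.ofReal_re]
  simp_rw [hf]
  set f : Matrix.unitaryGroup (Fin (r + 4)) ℂ → ℝ := fun U =>
      cpGram (cpCol (cpTail (n := r + 2) ((U : Matrix (Fin (r + 4)) (Fin (r + 4)) ℂ)ᴴ * B)) 0)
        (cpCol (cpTail (n := r + 2) ((U : Matrix (Fin (r + 4)) (Fin (r + 4)) ℂ)ᴴ * B)) 1) with hfdef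
  have hfL : ∀ U, f U = cpGram (cpL (n := r + 2) (U : Matrix (Fin (r + 4)) (Fin (r + 4)) ℂ) (cpCol B 0))
      (cpL (n := r + 2) (U : Matrix (Fin (r + 4)) (Fin (r + 4)) ℂ) (cpCol B 1)) := by
    intro U
    have h0 := cpCol_cpTail0 (n := r + 2) (U : Matrix (Fin (r + 4)) (Fin (r + 4)) ℂ)
      (cpCol B 0) (cpCol B 1)
    have h1 := cpCol_cpTail1 (n := r + 2) (U : Matrix (Fin (r + 4)) (Fin (r + 4)) ℂ)
      (cpCol B 0) (cpCol B 1)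
    rw [cpMat_cpCol] at h0 h1
    simp only [hfdef]
    rw [h0, h1]
  have hfc : Continuous f := by
    have hL : ∀ x, Continuous (fun U : Matrix.unitaryGroup (Fin (r + 4)) ℂ =>
        cpL (n := r + 2) (U : Matrix (Fin (r + 4)) (Fin (r + 4)) ℂ) x) := by
      intro x
      exact cpL_continuous.comp (f := fun U : Matrix.unitaryGroup (Fin (r + 4)) ℂ =>
        ((U : Matrix (Fin (r + 4)) (Fin (r + 4)) ℂ), x)) (by fun_prop)
    rw [funext hfL]
    exact cpGram_continuous.comp ((hL _).prodMk (hL _))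
  have hBn : ∀ j, ‖cpCol B j‖ = 1 := by
    intro j
    have h := cpCol_inner B j j
    rw [hB, Matrix.one_apply_eq, inner_self_eq_norm_sq_to_K] at h
    have h2 : ((‖cpCol B j‖ ^ 2 : ℝ) : ℂ) = 1 := by
      rw [← h]; simp
    have h' : ‖cpCol B j‖ ^ 2 = 1 := Complex.ofReal_eq_one.mp h2
    exact (pow_eq_one_iff_of_nonneg (norm_nonneg _) (by norm_num)).mp h'
  have hf01 : ∀ U, f U ∈ Set.Icc (0:ℝ) 1 := by
    intro U
    rw [hfL]
    refine ⟨cpGram_nonneg _ _, (cpGram_le _ _).trans ?_⟩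
    have h0 := cpL_norm_le (n := r + 2) U (cpCol B 0)
    have h1 := cpL_norm_le (n := r + 2) U (cpCol B 1)
    rw [hBn] at h0 h1
    have h0' := pow_le_one₀ (n := 2) (norm_nonneg _) h0
    have h1' := pow_le_one₀ (n := 2) (norm_nonneg _) h1
    exact mul_le_one₀ h0' (by positivity) h1'
  set w : ℝ → ℝ := fun x => if x ∈ Set.Ioo (0 : ℝ) 1 then
            (1 / 2) * ((r : ℝ) + 3) * ((r : ℝ) + 2) ^ 2 * ((r : ℝ) + 1) * x ^ r *
              (1 - x ^ 2 + 2 * x * Real.log x)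
          else 0 with hw
  set C : ℝ := (1 / 2) * ((r : ℝ) + 3) * ((r : ℝ) + 2) ^ 2 * ((r : ℝ) + 1) with hC
  have hwind : w = (Set.Ioo (0:ℝ) 1).indicator
      (fun x => C * x ^ r * (1 - x ^ 2 + 2 * x * Real.log x)) := by
    ext x
    simp only [hw, Set.indicator]
  have hw0 : ∀ x, 0 ≤ w x := by
    intro x
    simp only [hw]
    split_ifs with hx
    · have := cp_log_ineq x hx
      have := hx.1
      positivity
    · exact le_rfl
  have hcont : Continuous (fun x : ℝ => C * x ^ r * (1 - x ^ 2 + 2 * x * Real.log x)) := by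
    have h := Real.continuous_mul_log
    have : (fun x : ℝ => C * x ^ r * (1 - x ^ 2 + 2 * x * Real.log x)) =
      fun x : ℝ => C * x ^ r * (1 - x ^ 2 + 2 * (x * Real.log x)) := by ext x; ring
    rw [this]
    fun_prop
  have hwm : Measurable w := by
    rw [hwind]
    exact hcont.measurable.indicator measurableSet_Ioo
  have hwint : Integrable w := by
    rw [hwind, integrable_indicator_iff measurableSet_Ioo]
    exact (hcont.continuousOn.integrableOn_compact isCompact_Icc).mono_set Set.Ioo_subset_Icc_self
  have hfin : IsFiniteMeasure ((volume : Measure ℝ).withDensity (fun x => ENNReal.ofReal (w x))) :=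
    isFiniteMeasure_withDensity_ofReal hwint.2
  have hprob : IsProbabilityMeasure (μ.map f) :=
    Measure.isProbabilityMeasure_map hfc.measurable.aemeasurable
  change μ.map f = (volume : Measure ℝ).withDensity (fun x => ENNReal.ofReal (w x))
  apply cp_ext_moments
  · exact (ae_map_iff (p := fun x => x ∈ Set.Icc (0:ℝ) 1) hfc.measurable.aemeasurable
      measurableSet_Icc).mpr (Filter.Eventually.of_forall hf01)
  · rw [ae_withDensity_iff hwm.ennreal_ofReal]
    refine Filter.Eventually.of_forall fun x hx => ?_
    by_contra hx'
    apply hx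
    have : x ∉ Set.Ioo (0:ℝ) 1 := fun h => hx' (Set.Ioo_subset_Icc_self h)
    simp only [hw, if_neg this, ENNReal.ofReal_zero]
  · intro k
    rw [integral_map hfc.measurable.aemeasurable (by fun_prop),
      integral_withDensity_eq_integral_toReal_smul hwm.ennreal_ofReal (by simp)]
    have hR : ∫ x, (ENNReal.ofReal (w x)).toReal • x ^ k =
        C * (2 / (((r:ℝ) + k + 1) * ((r:ℝ) + k + 2) ^ 2 * ((r:ℝ) + k + 3))) := by
      have e : ∀ x, (ENNReal.ofReal (w x)).toReal • x ^ k = (Set.Ioo (0:ℝ) 1).indicator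
          (fun x => C * (x ^ (r + k) * (1 - x ^ 2 + 2 * x * Real.log x))) x := by
        intro x
        rw [ENNReal.toReal_ofReal (hw0 x), hwind]
        simp only [Set.indicator]
        split_ifs
        · rw [smul_eq_mul, pow_add]; ring
        · simp
      simp_rw [e]
      rw [integral_indicator measurableSet_Ioo, integral_const_mul, ← integral_Ioc_eq_integral_Ioo,
        ← intervalIntegral.integral_of_le zero_le_one, cp_density_integral]
      push_cast
      rfl
    rw [hR]
    have hck := cp_ck (m := r + 1) (by omega) μ B hB k
    have hck' : (∫ U, f U ^ k ∂μ) * (cpM (r + 4) k * cpM (r + 3) k) =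
      cpM (r + 2) k * cpM (r + 1) k := hck
    have r1 := cpM_ratio (r + 1) k (by omega)
    have r2 := cpM_ratio (r + 2) k (by omega)
    have p1 := cpM_pos (r + 1) k (by omega)
    have p2 := cpM_pos (r + 2) k (by omega)
    push_cast at r1 r2
    rw [show r + 1 + 2 = r + 3 by ring] at r1
    rw [show r + 2 + 2 = r + 4 by ring] at r2
    generalize ∫ U, f U ^ k ∂μ = I at *
    generalize cpM (r + 1) k = a at *
    generalize cpM (r + 2) k = b at *
    have hr3 : cpM (r + 3) k = a * (((r:ℝ) + 1 + k + 1) * (r + 1 + k)) / (((r:ℝ) + 1 + 1) * (r + 1)) := by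
      rw [eq_div_iff (by positivity)]; exact r1
    have hr4 : cpM (r + 4) k = b * (((r:ℝ) + 2 + k + 1) * (r + 2 + k)) / (((r:ℝ) + 2 + 1) * (r + 2)) := by
      rw [eq_div_iff (by positivity)]; exact r2
    rw [hr3, hr4] at hck'
    rw [hC]
    have hne : (b * (((r:ℝ) + 2 + k + 1) * (r + 2 + k)) / (((r:ℝ) + 2 + 1) * (r + 2)) *
        (a * (((r:ℝ) + 1 + k + 1) * (r + 1 + k)) / (((r:ℝ) + 1 + 1) * (r + 1)))) ≠ 0 := by
      positivity
    apply mul_right_cancel₀ hne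
    rw [hck']
    have q1 : ((r:ℝ) + k + 1) ≠ 0 := by positivity
    have q2 : ((r:ℝ) + k + 2) ≠ 0 := by positivity
    have q3 : ((r:ℝ) + k + 3) ≠ 0 := by positivity
    field_simp
    ring

end ChordalFinal

theorem chordal_product_pdf_M2
    (T : ℕ) (hT : 4 ≤ T)
    (B : Matrix (Fin T) (Fin 2) ℂ) (hB : Bᴴ * B = 1)
    (μ : Measure (Matrix.unitaryGroup (Fin T) ℂ))
    [IsProbabilityMeasure μ] [μ.IsMulLeftInvariant] :
    μ.map (fun U : Matrix.unitaryGroup (Fin T) ℂ =>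
        ((1 - Bᴴ * ((U : Matrix (Fin T) (Fin T) ℂ) * stdFrame T 2) *
            ((U : Matrix (Fin T) (Fin T) ℂ) * stdFrame T 2)ᴴ * B).det).re)
      = volume.withDensity (fun x : ℝ =>
          ENNReal.ofReal (if x ∈ Set.Ioo (0 : ℝ) 1 then
            (1 / 2) * ((T : ℝ) - 1) * ((T : ℝ) - 2) ^ 2 * ((T : ℝ) - 3) * x ^ (T - 4) *
              (1 - x ^ 2 + 2 * x * Real.log x)
          else 0)) := by
  obtain ⟨r, rfl⟩ : ∃ r, T = r + 4 := ⟨T - 4, by omega⟩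
  have h := cp_main r B hB μ
  rw [h]
  have e1 : ((r + 4 : ℕ) : ℝ) - 1 = r + 3 := by push_cast; ring
  have e2 : ((r + 4 : ℕ) : ℝ) - 2 = r + 2 := by push_cast; ring
  have e3 : ((r + 4 : ℕ) : ℝ) - 3 = r + 1 := by push_cast; ring
  rw [e1, e2, e3, Nat.add_sub_cancel]
end
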